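/- Let n ≥ 2, let B be a skew-symmetrizable n×n integer matrix of type C_n, fix 1 ≤ k ≤ n, and let B_1 = μ_k(B). Let (k_1,…,k_m) be any finite sequence of indices in {1,…,n} and let 1 ≤ l ≤ n. Let g = (g_1,…,g_n) be the g-vector of the l-th cluster variable of the seed μ_{k_m}⋯μ_{k_1}(B̃, (x_1,…,x_n)) in the cluster pattern with principal coefficients and initial matrix B, and let g′ = (g′_1,…,g′_n) be the g-vector of the l-th cluster variable of the seed μ_{k_m}⋯μ_{k_1}μ_k(B̃_1, (x_1,…,x_n)) in the cluster pattern with principal coefficients and initial matrix B_1. Then g′_k = −g_k, and g′_j = g_j + [B_{jk}]_+·g_k − B_{jk}·min(g_k, 0) for every j ≠ k. -/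

import Mathlib

open MvPolynomial Matrix

noncomputable section

/-- Fomin–Zelevinsky matrix mutation in direction `k`. -/
def mutMat {n : ℕ} (k : Fin n) (B : Matrix (Fin n) (Fin n) ℤ) :
    Matrix (Fin n) (Fin n) ℤ := fun i j =>
  if i = k ∨ j = k then -B i j
  else B i j + (B i k).sign * max (B i k * B k j) 0

/-- `B` is skew-symmetrizable: `D * B` is skew-symmetric for some diagonal `D`
with positive integer diagonal entries. -/
def SkewSymmetrizable {n : ℕ} (B : Matrix (Fin n) (Fin n) ℤ) : Prop :=
  ∃ d : Fin n → ℤ, (∀ i, 0 < d i) ∧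
    (Matrix.diagonal d * B)ᵀ = -(Matrix.diagonal d * B)

/-- The Cartan counterpart `A(B)` of `B`. -/
def cartanCounterpart {n : ℕ} (B : Matrix (Fin n) (Fin n) ℤ) :
    Matrix (Fin n) (Fin n) ℤ := fun i j => if i = j then 2 else -|B i j|

/-- The Cartan matrix of type `C_n` (with rows and columns indexed by
`0, …, n-1`): `2` on the diagonal, `-2` in position `(n-2, n-1)`, and `-1`
in the remaining positions `(i, i±1)`. -/
def cartanC (n : ℕ) : Matrix (Fin n) (Fin n) ℤ := fun i j =>
  if i = j then 2
  else if i.val + 2 = n ∧ j.val + 1 = n then -2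
  else if i.val + 1 = j.val ∨ j.val + 1 = i.val then -1 else 0

/-- The matrix `B` is of type `C_n`: some matrix obtained from `B` by a finite
sequence of mutations has Cartan counterpart equal, up to simultaneous
permutation of rows and columns, to the Cartan matrix of type `C_n`. -/
def MatrixOfTypeC {n : ℕ} (B : Matrix (Fin n) (Fin n) ℤ) : Prop :=
  ∃ B', Relation.ReflTransGen (fun a c => ∃ k, c = mutMat k a) B B' ∧
    ∃ σ : Equiv.Perm (Fin n),
      ∀ i j, cartanCounterpart B' (σ i) (σ j) = cartanC n i j

/-- Mutation in direction `k` of a `2n × n` integer matrix (rows indexed by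
`Fin n ⊕ Fin n`, the first block being the principal part). -/
def mutMatExt {n : ℕ} (k : Fin n) (b : Matrix (Fin n ⊕ Fin n) (Fin n) ℤ) :
    Matrix (Fin n ⊕ Fin n) (Fin n) ℤ := fun i j =>
  if i = Sum.inl k ∨ j = k then -b i j
  else b i j + (b i k).sign * max (b i k * b (Sum.inl k) j) 0

/-- The `2n × n` matrix `B̃` with top part `B` and bottom part the identity. -/
def extMat {n : ℕ} (B : Matrix (Fin n) (Fin n) ℤ) :
    Matrix (Fin n ⊕ Fin n) (Fin n) ℤ := fun i j =>
  Sum.elim (fun i' => B i' j) (fun i' => if i' = j then 1 else 0) i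

/-- The `2n × n` exchange matrices of the principal-coefficients pattern with
initial matrix `B`: all matrices obtained from `B̃` by finite sequences of
mutations. -/
def IsExtMat {n : ℕ} (B : Matrix (Fin n) (Fin n) ℤ)
    (b : Matrix (Fin n ⊕ Fin n) (Fin n) ℤ) : Prop :=
  Relation.ReflTransGen (fun a c => ∃ k, c = mutMatExt k a) (extMat B) b

/-- `c` is a `c`-vector of the cluster algebra with principal coefficients and
initial exchange matrix `B`: a column of the bottom part of some exchange
matrix of the pattern. -/
def IsCVec {n : ℕ} (B : Matrix (Fin n) (Fin n) ℤ) (c : Fin n → ℤ) : Prop :=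
  ∃ b, IsExtMat B b ∧ ∃ j, c = fun i => b (Sum.inr i) j

/-- The ambient field `ℚ(x_1, …, x_{2n})` for principal coefficients. -/
abbrev PField (n : ℕ) : Type := FractionRing (MvPolynomial (Fin n ⊕ Fin n) ℚ)

/-- The generators `x_1, …, x_{2n}` of `PField n`. -/
def xVar (n : ℕ) (i : Fin n ⊕ Fin n) : PField n :=
  algebraMap (MvPolynomial (Fin n ⊕ Fin n) ℚ) (PField n) (X i)

/-- Seed mutation in direction `k` for the principal-coefficients pattern. -/
def mutSeedP {n : ℕ} (k : Fin n)
    (s : Matrix (Fin n ⊕ Fin n) (Fin n) ℤ × (Fin n → PField n)) :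
    Matrix (Fin n ⊕ Fin n) (Fin n) ℤ × (Fin n → PField n) :=
  (mutMatExt k s.1,
    Function.update s.2 k
      (((∏ i, s.2 i ^ (s.1 (Sum.inl i) k).toNat) *
            ∏ j, xVar n (Sum.inr j) ^ (s.1 (Sum.inr j) k).toNat +
          (∏ i, s.2 i ^ (-(s.1 (Sum.inl i) k)).toNat) *
            ∏ j, xVar n (Sum.inr j) ^ (-(s.1 (Sum.inr j) k)).toNat) / s.2 k))

/-- The initial seed of the principal-coefficients pattern. -/
def initSeedP (n : ℕ) (B : Matrix (Fin n) (Fin n) ℤ) :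
    Matrix (Fin n ⊕ Fin n) (Fin n) ℤ × (Fin n → PField n) :=
  (extMat B, fun i => xVar n (Sum.inl i))

/-- The seeds of the principal-coefficients pattern with initial matrix `B`. -/
def IsSeedP {n : ℕ} (B : Matrix (Fin n) (Fin n) ℤ)
    (s : Matrix (Fin n ⊕ Fin n) (Fin n) ℤ × (Fin n → PField n)) : Prop :=
  Relation.ReflTransGen (fun a b => ∃ k, b = mutSeedP k a) (initSeedP n B) s

/-- The `ℤⁿ`-degree of the monomial with exponent vector `m`, where
`deg x_i = e_i` and `deg x_{n+j} = -(B_{1j}, …, B_{nj})`. -/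
def wtOf {n : ℕ} (B : Matrix (Fin n) (Fin n) ℤ)
    (m : (Fin n ⊕ Fin n) →₀ ℕ) : Fin n → ℤ := fun i =>
  (m (Sum.inl i) : ℤ) - ∑ j, (m (Sum.inr j) : ℤ) * B i j

/-- A polynomial is homogeneous of degree `g` for the principal-coefficients
`ℤⁿ`-grading determined by `B`. -/
def IsHomogOfWt {n : ℕ} (B : Matrix (Fin n) (Fin n) ℤ) (g : Fin n → ℤ)
    (p : MvPolynomial (Fin n ⊕ Fin n) ℚ) : Prop :=
  ∀ m ∈ p.support, wtOf B m = g

/-- `y` is homogeneous of degree `g` for the `ℤⁿ`-grading determined by `B`;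
for a cluster variable `y`, the vector `g` is its `g`-vector. -/
def HasGVector {n : ℕ} (B : Matrix (Fin n) (Fin n) ℤ) (g : Fin n → ℤ)
    (y : PField n) : Prop :=
  ∃ p q : MvPolynomial (Fin n ⊕ Fin n) ℚ, ∃ gp gq : Fin n → ℤ,
    IsHomogOfWt B gp p ∧ IsHomogOfWt B gq q ∧ q ≠ 0 ∧
      y = algebraMap (MvPolynomial (Fin n ⊕ Fin n) ℚ) (PField n) p /
            algebraMap (MvPolynomial (Fin n ⊕ Fin n) ℚ) (PField n) q ∧
      g = gp - gq

/-! ### Matrix mutations and C-matrices -/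

lemma mutMat_mutMat {n : ℕ} (k : Fin n) (B : Matrix (Fin n) (Fin n) ℤ) :
    mutMat k (mutMat k B) = B := by
  ext i j
  by_cases hi : i = k
  · simp [mutMat, hi]
  · by_cases hj : j = k
    · simp [mutMat, hj]
    · simp [mutMat, hi, hj]

lemma mutMat_neg {n : ℕ} (k : Fin n) (B : Matrix (Fin n) (Fin n) ℤ) :
    mutMat k (-B) = -mutMat k B := by
  ext i j
  by_cases hi : i = k
  · simp [mutMat, hi]
  · by_cases hj : j = k
    · simp [mutMat, hj]
    · simp [mutMat, hi, hj]; ring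

/-- `d` is a left skew-symmetrizer of `B`. -/
def SkD {n : ℕ} (d : Fin n → ℤ) (B : Matrix (Fin n) (Fin n) ℤ) : Prop :=
  ∀ i j, d i * B i j = -(d j * B j i)

lemma max_zero_cases (x : ℤ) : (0 ≤ x ∧ max x 0 = x) ∨ (x ≤ 0 ∧ max x 0 = 0) := by
  rcases le_total 0 x with h | h
  · exact Or.inl ⟨h, max_eq_left h⟩
  · exact Or.inr ⟨h, max_eq_right h⟩

/-- The mutation rule splits according to signs of the two factors. -/
lemma sign_mul_max (x y : ℤ) :
    x.sign * max (x * y) 0 = max x 0 * max y 0 - max (-x) 0 * max (-y) 0 := by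
  rcases lt_trichotomy x 0 with hx | hx | hx
  · rw [Int.sign_eq_neg_one_of_neg hx, max_eq_right hx.le, max_eq_left (by omega : 0 ≤ -x)]
    rcases le_total 0 y with hy | hy
    · rw [max_eq_right (by nlinarith : x * y ≤ 0), max_eq_right (by omega : -y ≤ 0)]; ring
    · rw [max_eq_left (by nlinarith : 0 ≤ x * y), max_eq_left (by omega : 0 ≤ -y)]; ring
  · simp [hx]
  · rw [Int.sign_eq_one_of_pos hx, max_eq_left hx.le, max_eq_right (by omega : -x ≤ 0)]
    rcases le_total 0 y with hy | hy
    · rw [max_eq_left (by nlinarith : 0 ≤ x * y), max_eq_left hy]; ring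
    · rw [max_eq_right (by nlinarith : x * y ≤ 0), max_eq_right hy]; ring

lemma max_mul_of_pos (a x : ℤ) (ha : 0 < a) : max (a * x) 0 = a * max x 0 := by
  rw [mul_max_of_nonneg _ _ ha.le]; simp

lemma SkD.mut {n : ℕ} {d : Fin n → ℤ} (hd : ∀ i, 0 < d i)
    {B : Matrix (Fin n) (Fin n) ℤ} (h : SkD d B) (k : Fin n) : SkD d (mutMat k B) := by
  intro i j
  by_cases hi : i = k ∨ j = k
  · have hj : j = k ∨ i = k := hi.symm
    simp [mutMat, hi, hj, h i j]
  · have hj : ¬ (j = k ∨ i = k) := fun h => hi h.symm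
    simp only [mutMat, hi, hj, if_false, sign_mul_max]
    have h1 := h i j
    have key : ∀ a b, d a * max (B a b) 0 = d b * max (-B b a) 0 := by
      intro a b
      rw [← max_mul_of_pos _ _ (hd a), ← max_mul_of_pos _ _ (hd b), h a b]
      congr 1; ring
    have key' : ∀ a b, d a * max (-B a b) 0 = d b * max (B b a) 0 := fun a b => (key b a).symm
    have e1 := key i k
    have e2 := key' i k
    have e3 := key k j
    have e4 := key' k j
    calc d i * (B i j + (max (B i k) 0 * max (B k j) 0 - max (-B i k) 0 * max (-B k j) 0))
        = d i * B i j + ((d i * max (B i k) 0) * max (B k j) 0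
            - (d i * max (-B i k) 0) * max (-B k j) 0) := by ring
      _ = -(d j * B j i) + (max (-B k i) 0 * (d k * max (B k j) 0)
            - max (B k i) 0 * (d k * max (-B k j) 0)) := by rw [e1, e2, h1]; ring
      _ = _ := by rw [e3, e4]; ring

lemma SkD.neg {n : ℕ} {d : Fin n → ℤ}
    {B : Matrix (Fin n) (Fin n) ℤ} (h : SkD d B) : SkD d (-B) := by
  intro i j; simp [h i j]

lemma SkD.diag {n : ℕ} {d : Fin n → ℤ} (hd : ∀ i, 0 < d i)
    {B : Matrix (Fin n) (Fin n) ℤ} (h : SkD d B) (k : Fin n) : B k k = 0 := by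
  have := h k k
  have h2 : d k * B k k = 0 := by omega
  rcases mul_eq_zero.mp h2 with h3 | h3
  · have := hd k; omega
  · exact h3

/-- Elementary matrix describing the mutation of C-matrices. -/
def Em {n : ℕ} (k : Fin n) (e : ℤ) (B : Matrix (Fin n) (Fin n) ℤ) :
    Matrix (Fin n) (Fin n) ℤ := fun i j =>
  if i = k then (if j = k then -1 else max (e * B k j) 0) else if i = j then 1 else 0

/-- Elementary matrix describing the mutation of G-matrices. -/
def Fm {n : ℕ} (k : Fin n) (e : ℤ) (B : Matrix (Fin n) (Fin n) ℤ) :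
    Matrix (Fin n) (Fin n) ℤ := fun i j =>
  if j = k then (if i = k then -1 else max (-e * B i k) 0) else if i = j then 1 else 0

lemma mul_Em_apply {n : ℕ} (k : Fin n) (e : ℤ) (B C : Matrix (Fin n) (Fin n) ℤ) (i j : Fin n) :
    (C * Em k e B) i j = if j = k then -C i k else C i j + C i k * max (e * B k j) 0 := by
  rw [Matrix.mul_apply, ← Finset.add_sum_erase _ _ (Finset.mem_univ k)]
  have : ∀ x ∈ Finset.univ.erase k, C i x * Em k e B x j = if x = j then C i x else 0 := by
    intro x hx
    have hx' : x ≠ k := (Finset.mem_erase.mp hx).1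
    simp [Em, hx']
  rw [Finset.sum_congr rfl this, Finset.sum_ite_eq']
  by_cases hj : j = k
  · simp [hj, Em]
  · simp [hj, Em]; ring

lemma Em_mul_apply {n : ℕ} (k : Fin n) (e : ℤ) (B C : Matrix (Fin n) (Fin n) ℤ) (i j : Fin n) :
    (Em k e B * C) i j = if i = k then -C k j + ∑ x ∈ Finset.univ.erase k, max (e * B k x) 0 * C x j
      else C i j := by
  rw [Matrix.mul_apply]
  by_cases hi : i = k
  · rw [if_pos hi, ← Finset.add_sum_erase _ _ (Finset.mem_univ k)]
    congr 1
    · simp [Em, hi]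
    · apply Finset.sum_congr rfl
      intro x hx
      simp [Em, hi, (Finset.mem_erase.mp hx).1]
  · simp [Em, hi]

lemma mul_Fm_apply {n : ℕ} (k : Fin n) (e : ℤ) (B C : Matrix (Fin n) (Fin n) ℤ) (i j : Fin n) :
    (C * Fm k e B) i j = if j = k then -C i k + ∑ x ∈ Finset.univ.erase k, C i x * max (-e * B x k) 0
      else C i j := by
  rw [Matrix.mul_apply]
  by_cases hi : j = k
  · rw [if_pos hi, ← Finset.add_sum_erase _ _ (Finset.mem_univ k)]
    congr 1
    · simp [Fm, hi]
    · apply Finset.sum_congr rfl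
      intro x hx
      simp [Fm, hi, (Finset.mem_erase.mp hx).1]
  · simp [Fm, hi]

lemma Fm_mul_apply {n : ℕ} (k : Fin n) (e : ℤ) (B C : Matrix (Fin n) (Fin n) ℤ) (i j : Fin n) :
    (Fm k e B * C) i j = if i = k then -C k j else C i j + max (-e * B i k) 0 * C k j := by
  rw [Matrix.mul_apply, ← Finset.add_sum_erase _ _ (Finset.mem_univ k)]
  have : ∀ x ∈ Finset.univ.erase k, Fm k e B i x * C x j = if i = x then C x j else 0 := by
    intro x hx
    have hx' : x ≠ k := (Finset.mem_erase.mp hx).1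
    simp [Fm, hx']
  rw [Finset.sum_congr rfl this, Finset.sum_ite_eq]
  by_cases hj : i = k
  · simp [hj, Fm]
  · simp [hj, Fm]; ring

lemma Em_mul_Em {n : ℕ} (k : Fin n) (e : ℤ) (B : Matrix (Fin n) (Fin n) ℤ) :
    Em k e B * Em k e B = 1 := by
  ext i j
  rw [mul_Em_apply]
  by_cases hj : j = k
  · by_cases hi : i = k
    · subst hi; subst hj; simp [Em]
    · simp [hi, hj, Em]
  · by_cases hi : i = k
    · subst hi; simp [hj, Em, Ne.symm hj]
    · simp [hi, hj, Em, Matrix.one_apply]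

lemma Fm_mul_Fm {n : ℕ} (k : Fin n) (e : ℤ) (B : Matrix (Fin n) (Fin n) ℤ) :
    Fm k e B * Fm k e B = 1 := by
  ext i j
  rw [Fm_mul_apply]
  by_cases hj : j = k
  · by_cases hi : i = k
    · subst hi; subst hj; simp [Fm]
    · simp [hi, hj, Fm]
  · by_cases hi : i = k
    · subst hi; simp [hj, Fm, Ne.symm hj]
    · simp [hi, hj, Ne.symm hj, Fm, Matrix.one_apply]

lemma Em_neg {n : ℕ} (k : Fin n) (e : ℤ) (B : Matrix (Fin n) (Fin n) ℤ) :
    Em k e (-B) = Em k (-e) B := by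
  ext i j; simp [Em]

lemma Em_mut {n : ℕ} (k : Fin n) (e : ℤ) (B : Matrix (Fin n) (Fin n) ℤ) :
    Em k e (mutMat k B) = Em k (-e) B := by
  ext i j; simp [Em, mutMat]

lemma diag_mul_Em {n : ℕ} {d : Fin n → ℤ} (hd : ∀ i, 0 < d i)
    {B : Matrix (Fin n) (Fin n) ℤ} (h : SkD d B) (k : Fin n) (e : ℤ) :
    Matrix.diagonal d * Em k e B = (Fm k e B)ᵀ * Matrix.diagonal d := by
  ext i j
  rw [Matrix.diagonal_mul, Matrix.mul_diagonal, Matrix.transpose_apply]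
  by_cases hi : i = k
  · by_cases hj : j = k
    · simp [Em, Fm, hi, hj]
    · simp only [Em, Fm, hi, hj, if_true, if_false]
      rw [← max_mul_of_pos _ _ (hd k), mul_comm _ (d j), ← max_mul_of_pos _ _ (hd j)]
      congr 1
      have := h k j
      calc d k * (e * B k j) = e * (d k * B k j) := by ring
        _ = _ := by rw [this]; ring
  · by_cases hj : i = j
    · subst hj; simp [Em, Fm, hi]
    · simp [Em, Fm, hi, hj, Ne.symm hj]

/-- Congruence formula for matrix mutation. -/
lemma Em_congr {n : ℕ} {d : Fin n → ℤ} (hd : ∀ i, 0 < d i)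
    {B : Matrix (Fin n) (Fin n) ℤ} (h : SkD d B) (k : Fin n) (e : ℤ) (he : e = 1 ∨ e = -1) :
    (Em k e B)ᵀ * (Matrix.diagonal d * B) * Em k e B = Matrix.diagonal d * mutMat k B := by
  have h1 : (Em k e B)ᵀ * Matrix.diagonal d = Matrix.diagonal d * Fm k e B := by
    have := congrArg Matrix.transpose (diag_mul_Em hd h k e)
    simpa [Matrix.transpose_mul] using this
  rw [← Matrix.mul_assoc, h1, Matrix.mul_assoc, Matrix.mul_assoc]
  congr 1
  ext i j
  rw [Fm_mul_apply, mul_Em_apply, mul_Em_apply]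
  have hk := h.diag hd k
  by_cases hi : i = k
  · by_cases hj : j = k
    · simp [mutMat, hi, hj, hk]
    · simp [mutMat, hi, hj, hk]
  · by_cases hj : j = k
    · simp [mutMat, hi, hj, hk]
    · simp only [mutMat, hi, hj, hk, if_false, or_self, sign_mul_max]
      have pn : ∀ x : ℤ, x = max x 0 - max (-x) 0 := by
        intro x
        rcases max_zero_cases x with ⟨h1, h2⟩ | ⟨h1, h2⟩ <;>
        rcases max_zero_cases (-x) with ⟨h3, h4⟩ | ⟨h3, h4⟩ <;> omega
      have e1 := pn (B i k)
      have e2 := pn (B k j)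
      rcases he with rfl | rfl
      · simp only [one_mul, neg_mul]
        linear_combination max (B k j) 0 * e1 + max (-B i k) 0 * e2
      · simp only [one_mul, neg_mul, neg_neg]
        linear_combination max (-B k j) 0 * e1 + max (B i k) 0 * e2

/-- Exchange matrix after a sequence of mutations. -/
def Bp {n : ℕ} (B : Matrix (Fin n) (Fin n) ℤ) (ls : List (Fin n)) :
    Matrix (Fin n) (Fin n) ℤ := ls.foldl (fun b k => mutMat k b) B

/-- Mutation of a C-matrix. -/
def mutC {n : ℕ} (k : Fin n) (B C : Matrix (Fin n) (Fin n) ℤ) :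
    Matrix (Fin n) (Fin n) ℤ := fun i j =>
  if j = k then -C i j else C i j + (C i k).sign * max (C i k * B k j) 0

/-- C-matrix after a sequence of mutations, starting from an arbitrary `C`. -/
def Cp {n : ℕ} (B C : Matrix (Fin n) (Fin n) ℤ) : List (Fin n) → Matrix (Fin n) (Fin n) ℤ
  | [] => C
  | k :: ls => Cp (mutMat k B) (mutC k B C) ls

lemma Bp_append {n : ℕ} (B : Matrix (Fin n) (Fin n) ℤ) (ls : List (Fin n)) (k : Fin n) :
    Bp B (ls ++ [k]) = mutMat k (Bp B ls) := by simp [Bp]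

lemma Bp_cons {n : ℕ} (B : Matrix (Fin n) (Fin n) ℤ) (ls : List (Fin n)) (k : Fin n) :
    Bp B (k :: ls) = Bp (mutMat k B) ls := by simp [Bp]

lemma Bp_neg {n : ℕ} (B : Matrix (Fin n) (Fin n) ℤ) (ls : List (Fin n)) :
    Bp (-B) ls = -Bp B ls := by
  induction ls generalizing B with
  | nil => rfl
  | cons k ls ih => rw [Bp_cons, Bp_cons, mutMat_neg, ih]

lemma Bp_rev {n : ℕ} (B : Matrix (Fin n) (Fin n) ℤ) (ls : List (Fin n)) :
    Bp (Bp B ls) ls.reverse = B := by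
  induction ls generalizing B with
  | nil => rfl
  | cons k ls ih => rw [Bp_cons, List.reverse_cons, Bp_append, ih, mutMat_mutMat]

lemma Cp_append {n : ℕ} (B C : Matrix (Fin n) (Fin n) ℤ) (ls : List (Fin n)) (k : Fin n) :
    Cp B C (ls ++ [k]) = mutC k (Bp B ls) (Cp B C ls) := by
  induction ls generalizing B C with
  | nil => rfl
  | cons l ls ih => simp only [List.cons_append, Cp, ih, Bp_cons]

lemma SkD.bp {n : ℕ} {d : Fin n → ℤ} (hd : ∀ i, 0 < d i)
    {B : Matrix (Fin n) (Fin n) ℤ} (h : SkD d B) (ls : List (Fin n)) : SkD d (Bp B ls) := by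
  induction ls generalizing B with
  | nil => exact h
  | cons k ls ih => exact ih (h.mut hd k)

/-- The `j`-th column of `C` has sign `e`. -/
def Sg {n : ℕ} (e : ℤ) (C : Matrix (Fin n) (Fin n) ℤ) (j : Fin n) : Prop :=
  (e = 1 ∨ e = -1) ∧ ∀ i, 0 ≤ e * C i j

lemma mutC_eq {n : ℕ} (k : Fin n) (e : ℤ) (B C : Matrix (Fin n) (Fin n) ℤ) (h : Sg e C k) :
    mutC k B C = C * Em k e B := by
  ext i j
  rw [mul_Em_apply]
  by_cases hj : j = k
  · simp [mutC, hj]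
  · simp only [mutC, hj, if_false, sign_mul_max]
    obtain ⟨he | he, h2⟩ := h
    · have := h2 i
      subst he
      rw [max_eq_left (by omega : 0 ≤ C i k), max_eq_right (by omega : -C i k ≤ 0)]; simp
    · have := h2 i
      subst he
      rw [max_eq_right (by omega : C i k ≤ 0), max_eq_left (by omega : 0 ≤ -C i k)]; simp

/-! ### Tropical dualities from sign-coherence -/

/-- Sign-coherence of all C-matrices with initial matrix `B`. -/
def SC {n : ℕ} (B : Matrix (Fin n) (Fin n) ℤ) : Prop :=
  ∀ ls j, ∃ e, Sg e (Cp B 1 ls) j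

lemma cmat_data {n : ℕ} {d : Fin n → ℤ} (hd : ∀ i, 0 < d i)
    {B : Matrix (Fin n) (Fin n) ℤ} (h : SkD d B) (hs : SC B) (ls : List (Fin n)) :
    ∃ G Gi Ci : Matrix (Fin n) (Fin n) ℤ, G * Gi = 1 ∧ Cp B 1 ls * Ci = 1 ∧
      Gᵀ * Matrix.diagonal d * Cp B 1 ls = Matrix.diagonal d ∧
      (Cp B 1 ls)ᵀ * (Matrix.diagonal d * B) * Cp B 1 ls = Matrix.diagonal d * Bp B ls := by
  induction ls using List.reverseRecOn with
  | nil => exact ⟨1, 1, 1, by simp [Cp, Bp]⟩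
  | append_singleton ls k ih =>
    obtain ⟨G, Gi, Ci, h1, h2, h3, h4⟩ := ih
    obtain ⟨e, he⟩ := hs ls k
    have hB := h.bp hd ls
    rw [Cp_append, mutC_eq k e _ _ he, Bp_append]
    set E := Em k e (Bp B ls) with hE
    set F := Fm k e (Bp B ls) with hF
    have hEE : E * E = 1 := Em_mul_Em _ _ _
    have hFF : F * F = 1 := Fm_mul_Fm _ _ _
    have hDE : Matrix.diagonal d * E = Fᵀ * Matrix.diagonal d := diag_mul_Em hd hB k e
    have hcong := Em_congr hd hB k e he.1
    refine ⟨G * F, F * Gi, E * Ci, ?_, ?_, ?_, ?_⟩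
    · calc G * F * (F * Gi) = G * (F * F) * Gi := by simp only [Matrix.mul_assoc]
        _ = 1 := by rw [hFF, Matrix.mul_one, h1]
    · calc Cp B 1 ls * E * (E * Ci) = Cp B 1 ls * (E * E) * Ci := by simp only [Matrix.mul_assoc]
        _ = 1 := by rw [hEE, Matrix.mul_one, h2]
    · calc (G * F)ᵀ * Matrix.diagonal d * (Cp B 1 ls * E)
          = Fᵀ * (Gᵀ * Matrix.diagonal d * Cp B 1 ls) * E := by
            simp only [Matrix.mul_assoc, Matrix.transpose_mul]
        _ = Matrix.diagonal d * (E * E) := by rw [h3, ← hDE, Matrix.mul_assoc]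
        _ = _ := by rw [hEE, Matrix.mul_one]
    · calc (Cp B 1 ls * E)ᵀ * (Matrix.diagonal d * B) * (Cp B 1 ls * E)
          = Eᵀ * ((Cp B 1 ls)ᵀ * (Matrix.diagonal d * B) * Cp B 1 ls) * E := by
            simp only [Matrix.mul_assoc, Matrix.transpose_mul]
        _ = _ := by rw [h4, hcong]

lemma sg_eq_of_mul_pos {a b x : ℤ} (ha : a = 1 ∨ a = -1) (hb : b = 1 ∨ b = -1)
    (hx : x ≠ 0) (h1 : 0 ≤ a * x) (h2 : 0 ≤ b * x) : a = b := by
  rcases ha with rfl | rfl <;> rcases hb with rfl | rfl <;> omega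

lemma mutC_one {n : ℕ} (k : Fin n) (B : Matrix (Fin n) (Fin n) ℤ) :
    mutC k B 1 = Em k 1 B := by
  rw [mutC_eq k 1 B 1, Matrix.one_mul]
  refine ⟨Or.inl rfl, fun i => ?_⟩
  by_cases h : i = k <;> simp [Matrix.one_apply, h]

/-- The inverse of a C-matrix is the C-matrix of the reversed path for `-B`. -/
def HH {n : ℕ} (B : Matrix (Fin n) (Fin n) ℤ) (ls : List (Fin n)) : Prop :=
  Cp B 1 ls * Cp (-Bp B ls) 1 ls.reverse = 1

lemma left_mutation {n : ℕ} {d : Fin n → ℤ} (hd : ∀ i, 0 < d i)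
    {B : Matrix (Fin n) (Fin n) ℤ} (h : SkD d B) (hs : SC B) (k : Fin n)
    (hs0 : SC (mutMat k B)) (hsn : ∀ ls, SC (-Bp B ls)) (ls : List (Fin n))
    (hH : ∀ ls', ls'.length ≤ ls.length → HH B ls') :
    ∃ η, Sg η (Cp (-Bp B ls) 1 ls.reverse) k ∧
      Cp (mutMat k B) 1 (k :: ls) = Em k (-η) B * Cp B 1 ls := by
  induction ls using List.reverseRecOn with
  | nil =>
    refine ⟨1, ?_, ?_⟩
    · refine ⟨Or.inl rfl, fun i => ?_⟩
      by_cases h : i = k <;> simp [Cp, Matrix.one_apply, h]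
    · simp only [Cp, Matrix.mul_one]
      rw [mutC_one, Em_mut]
  | append_singleton ls l ih =>
    have hlen : ls.length ≤ (ls ++ [l]).length := by simp
    obtain ⟨η, hη, hC0⟩ := ih (fun ls' h' => hH ls' (h'.trans hlen))
    have hH1 := hH ls hlen
    have hH2 := hH (ls ++ [l]) le_rfl
    unfold HH at hH1 hH2
    obtain ⟨η', hη'⟩ := hsn (ls ++ [l]) (ls ++ [l]).reverse k
    obtain ⟨e, he⟩ := hs ls l
    obtain ⟨e0, he0⟩ := hs0 (k :: ls) l
    obtain ⟨G, Gi, Ci0, hG, -, hGD, hcong⟩ := cmat_data hd h hs ls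
    have hC0' : Cp (mutMat k B) 1 (k :: (ls ++ [l]))
        = Cp (mutMat k B) 1 (k :: ls) * Em l e0 (Bp B ls) := by
      have := Cp_append (mutMat k B) 1 (k :: ls) l
      rw [mutC_eq l e0 _ _ he0] at this
      simpa [Bp_cons, mutMat_mutMat] using this
    have hC1' : Cp B 1 (ls ++ [l]) = Cp B 1 ls * Em l e (Bp B ls) := by
      rw [Cp_append, mutC_eq l e _ _ he]
    refine ⟨η', hη', ?_⟩
    rw [hC0', hC1', hC0]
    rw [hC1'] at hH2
    rw [hC0] at he0
    set C := Cp B 1 ls with hCdef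
    set Bt := Bp B ls with hBt
    set Ci := Cp (-Bt) 1 ls.reverse with hCi
    set Ci' := Cp (-Bp B (ls ++ [l])) 1 (ls ++ [l]).reverse with hCi'
    have hinv : Ci * C = 1 := mul_eq_one_comm.mp hH1
    have hEE : Em l e Bt * Em l e Bt = 1 := Em_mul_Em _ _ _
    have hCi'' : Ci' = Em l e Bt * Ci := by
      calc Ci' = Em l e Bt * ((Ci * C) * Em l e Bt) * Ci' := by
            rw [hinv, Matrix.one_mul, hEE, Matrix.one_mul]
        _ = Em l e Bt * Ci * (C * Em l e Bt * Ci') := by simp only [Matrix.mul_assoc]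
        _ = _ := by rw [hH2, Matrix.mul_one]
    by_cases hcase : ∀ i, i ≠ k → C i l = 0
    · -- the `l`-th column of `C` is `± e_k`
      have hCx : ∀ (M : Matrix (Fin n) (Fin n) ℤ) i, (M * C) i l = M i k * C k l := by
        intro M i
        rw [Matrix.mul_apply, Finset.sum_eq_single k]
        · intro b _ hb; rw [hcase b hb, mul_zero]
        · simp
      have hu := hCx Ci l
      rw [hinv, Matrix.one_apply_eq] at hu
      have hCkl : C k l = e := by
        have h1 : IsUnit (C k l) := IsUnit.of_mul_eq_one (Ci l k) (by rw [mul_comm]; exact hu.symm)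
        rcases Int.isUnit_iff.mp h1 with h2 | h2 <;> have h3 := he.2 k <;> rw [h2] at h3 ⊢ <;>
          rcases he.1 with h4 | h4 <;> subst h4 <;> first | rfl | omega
      have hee : e * e = 1 := by rcases he.1 with h4 | h4 <;> subst h4 <;> rfl
      have hCik : ∀ i, Ci i k = if i = l then e else 0 := by
        intro i
        have h1 := hCx Ci i
        rw [hinv, hCkl, Matrix.one_apply] at h1
        have : Ci i k = (Ci i k * e) * e := by rw [mul_assoc, hee, mul_one]
        rw [this, ← h1]; split_ifs <;> simp
      have hηe : η = e := by
        have h1 := hη.2 l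
        rw [hCik l, if_pos rfl] at h1
        rcases hη.1 with h2 | h2 <;> rcases he.1 with h3 | h3 <;> subst h2 <;> subst h3 <;>
          first | rfl | omega
      have hη'e : η' = -e := by
        have h1 := hη'.2 l
        rw [hCi'', Em_mul_apply, if_pos rfl, hCik l, if_pos rfl, Finset.sum_eq_zero] at h1
        · rcases hη'.1 with h2 | h2 <;> rcases he.1 with h3 | h3 <;> subst h2 <;> subst h3 <;>
            first | rfl | omega
        · intro x hx
          rw [hCik x, if_neg (Finset.mem_erase.mp hx).1, mul_zero]
      have he0e : e0 = -e := by
        have h1 := he0.2 k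
        rw [hCx, hCkl] at h1
        simp only [Em, if_true] at h1
        rcases he0.1 with h2 | h2 <;> rcases he.1 with h3 | h3 <;> subst h2 <;> subst h3 <;>
            first | rfl | omega
      -- the two symmetrizer entries agree
      have hGk : ∀ j, d k * G k j * e = if j = l then d l else 0 := by
        intro j
        have h1 := congrFun (congrFun hGD j) l
        rw [hCx, hCkl, Matrix.mul_diagonal, Matrix.transpose_apply, Matrix.diagonal_apply] at h1
        rw [mul_comm (d k)]
        rw [h1]; split_ifs with h2 <;> simp [h2]
      have hdd : d l = d k := by
        have h1 := hGk l
        rw [if_pos rfl] at h1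
        have h2 := congrFun (congrFun hG k) k
        rw [Matrix.mul_apply, Matrix.one_apply_eq] at h2
        have h3 : d k = d l * (e * Gi l k) := by
          calc d k = d k * ∑ j, G k j * Gi j k := by rw [h2, mul_one]
            _ = ∑ j, (d k * G k j * e) * (e * Gi j k) := by
                rw [Finset.mul_sum]
                apply Finset.sum_congr rfl
                intro j _
                calc d k * (G k j * Gi j k) = d k * G k j * Gi j k * (1) := by ring
                  _ = _ := by rw [← hee]; ring
            _ = _ := by
                rw [Finset.sum_eq_single l]
                · rw [hGk, if_pos rfl]
                · intro b _ hb; rw [hGk, if_neg hb, zero_mul]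
                · simp
        have h4 : d k ∣ d l := ⟨G k l * e, by rw [← h1]; ring⟩
        have h5 : d l ∣ d k := ⟨_, h3⟩
        exact Int.dvd_antisymm (hd l).le (hd k).le h5 h4
      have hBC : ∀ j, (B * C) k j = e * Bt l j := by
        intro j
        have h1 := congrFun (congrFun hcong l) j
        have h2 : (Cᵀ * (Matrix.diagonal d * B) * C) l j = e * d k * (B * C) k j := by
          rw [Matrix.mul_assoc, Matrix.mul_assoc, Matrix.mul_apply, Finset.sum_eq_single k]
          · rw [Matrix.transpose_apply, hCkl, Matrix.diagonal_mul]; ring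
          · intro b _ hb; rw [Matrix.transpose_apply, hcase b hb, zero_mul]
          · simp
        rw [h2, Matrix.diagonal_mul, hdd] at h1
        have h3 : d k * (B * C) k j = d k * (e * Bt l j) := by
          calc d k * (B * C) k j = e * (e * d k * (B * C) k j) := by
                rw [← mul_assoc, ← mul_assoc, hee, one_mul]
            _ = _ := by rw [h1]; ring
        exact mul_left_cancel₀ (hd k).ne' h3
      have hprod : ∀ (m : Fin n) (A : Matrix (Fin n) (Fin n) ℤ) (hA : A m m = 0) (i j : Fin n),
          (Em m e A * Em m (-e) A) i j = (1 : Matrix (Fin n) (Fin n) ℤ) i j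
            + if i = m then e * A m j else 0 := by
        intro m A hA i j
        rw [mul_Em_apply]
        by_cases hj : j = m
        · by_cases hi : i = m
          · subst hi; subst hj; simp [Em, hA]
          · simp [Em, hi, hj]
        · by_cases hi : i = m
          · subst hi
            simp only [Em, hj, if_true, if_false, Matrix.one_apply, Ne.symm hj]
            have pn : ∀ x : ℤ, max x 0 - max (-x) 0 = x := by
              intro x
              rcases max_zero_cases x with ⟨h1, h2⟩ | ⟨h1, h2⟩ <;>
              rcases max_zero_cases (-x) with ⟨h3, h4⟩ | ⟨h3, h4⟩ <;> omega
            have := pn (e * A i j)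
            rw [show -e * A i j = -(e * A i j) by ring]; linarith
          · simp [Em, hi, hj, Matrix.one_apply]
      have hkey : Em k e B * Em k (-e) B * C = C * (Em l e Bt * Em l (-e) Bt) := by
        have e1 : Em k e B * Em k (-e) B = 1 + Matrix.of fun i j => if i = k then e * B k j else 0 := by
          ext i j; rw [hprod k B (h.diag hd k)]; rfl
        have e2 : Em l e Bt * Em l (-e) Bt
            = 1 + Matrix.of fun i j => if i = l then e * Bt l j else 0 := by
          ext i j; rw [hprod l Bt ((h.bp hd ls).diag hd l)]; rfl
        rw [e1, e2, Matrix.add_mul, Matrix.mul_add, Matrix.one_mul, Matrix.mul_one]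
        congr 1
        ext i j
        rw [Matrix.mul_apply, Matrix.mul_apply, Finset.sum_eq_single l (f := fun x => C i x * _)]
        · simp only [Matrix.of_apply, if_true]
          by_cases hi : i = k
          · subst hi
            simp only [if_true, hCkl]
            have := hBC j
            rw [Matrix.mul_apply] at this
            simp_rw [mul_assoc]
            rw [← Finset.mul_sum, this]
          · simp [hi, hcase i hi]
        · intro b _ hb; simp [hb]
        · simp
      rw [hηe, hη'e, he0e, neg_neg]
      calc Em k (-e) B * C * Em l (-e) Bt
          = (Em k e B * Em k e B) * Em k (-e) B * C * Em l (-e) Bt := by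
            rw [Em_mul_Em, Matrix.one_mul]
        _ = Em k e B * (Em k e B * Em k (-e) B * C) * Em l (-e) Bt := by
            simp only [Matrix.mul_assoc]
        _ = Em k e B * (C * Em l e Bt) * (Em l (-e) Bt * Em l (-e) Bt) := by
            rw [hkey]; simp only [Matrix.mul_assoc]
        _ = _ := by rw [Em_mul_Em, Matrix.mul_one]
    · push Not at hcase
      obtain ⟨i, hik, hi⟩ := hcase
      have he0e : e0 = e := by
        have h1 := he0.2 i
        rw [Em_mul_apply, if_neg hik] at h1
        exact sg_eq_of_mul_pos he0.1 he.1 hi h1 (he.2 i)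
      have hηη : η' = η := by
        by_contra hne
        have hz : ∀ j, j ≠ l → Ci j k = 0 := by
          intro j hj
          by_contra hnz
          have h1 := hη'.2 j
          rw [hCi'', Em_mul_apply, if_neg hj] at h1
          exact hne (sg_eq_of_mul_pos hη'.1 hη.1 hnz h1 (hη.2 j))
        have hM : ∀ j, (C * Ci) j k = C j l * Ci l k := by
          intro j
          rw [Matrix.mul_apply, Finset.sum_eq_single l]
          · intro b _ hb; rw [hz b hb, mul_zero]
          · simp
        have h1 := hM k
        have h2 := hM i
        rw [hH1, Matrix.one_apply_eq] at h1
        rw [hH1, Matrix.one_apply_ne hik] at h2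
        rcases mul_eq_zero.mp h2.symm with h3 | h3
        · exact hi h3
        · rw [h3, mul_zero] at h1; omega
      rw [he0e, hηη, Matrix.mul_assoc]

/-- A mutation- and negation-closed class of sign-coherent matrices satisfies the duality. -/
theorem duality {n : ℕ} {d : Fin n → ℤ} (hd : ∀ i, 0 < d i)
    (K : Matrix (Fin n) (Fin n) ℤ → Prop)
    (hKm : ∀ B k, K B → K (mutMat k B)) (hKn : ∀ B, K B → K (-B))
    (hKs : ∀ B, K B → SC B) (m : ℕ) :
    ∀ (B : Matrix (Fin n) (Fin n) ℤ) (ls : List (Fin n)), K B → SkD d B → ls.length ≤ m →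
      HH B ls := by
  have hKp : ∀ ls B, K B → K (Bp B ls) := by
    intro ls
    induction ls with
    | nil => intro B h; exact h
    | cons k ls ih => intro B h; exact ih _ (hKm _ _ h)
  induction m with
  | zero =>
    intro B ls _ _ hl
    have : ls = [] := List.length_eq_zero_iff.mp (by omega)
    subst this; simp [HH, Cp]
  | succ m ih =>
    intro B ls hK hd' hl
    cases ls with
    | nil => simp [HH, Cp]
    | cons k ls =>
      have hl' : ls.length ≤ m := by simpa using hl
      obtain ⟨η, hη, hC⟩ := left_mutation hd (hd'.mut hd k) (hKs _ (hKm _ k hK)) k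
        (by rw [mutMat_mutMat]; exact hKs _ hK) (fun ls => hKs _ (hKn _ (hKp _ _ (hKm _ k hK)))) ls
        (fun ls' h' => ih _ ls' (hKm _ k hK) (hd'.mut hd k) (h'.trans hl'))
      rw [mutMat_mutMat] at hC
      have hH := ih _ ls (hKm _ k hK) (hd'.mut hd k) hl'
      unfold HH at hH ⊢
      rw [hC, Bp_cons, List.reverse_cons, Cp_append, mutC_eq k η _ _ hη, Bp_neg, Bp_rev, Em_neg]
      set E := Em k (-η) (mutMat k B) with hE
      calc _ = E * (Cp (mutMat k B) 1 ls * Cp (-Bp (mutMat k B) ls) 1 ls.reverse) * E := by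
            simp only [Matrix.mul_assoc]
        _ = 1 := by rw [hH, Matrix.mul_one, Em_mul_Em]

/-! ### Degrees of cluster variables -/

/-- Homogeneous elements that are positive at the point `(1, …, 1)`. -/
def PosG {n : ℕ} (B : Matrix (Fin n) (Fin n) ℤ) (g : Fin n → ℤ) (y : PField n) : Prop :=
  ∃ p q : MvPolynomial (Fin n ⊕ Fin n) ℚ, ∃ gp gq : Fin n → ℤ,
    IsHomogOfWt B gp p ∧ IsHomogOfWt B gq q ∧ 0 < eval (fun _ => (1 : ℚ)) p ∧
      0 < eval (fun _ => (1 : ℚ)) q ∧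
      y = algebraMap (MvPolynomial (Fin n ⊕ Fin n) ℚ) (PField n) p /
            algebraMap (MvPolynomial (Fin n ⊕ Fin n) ℚ) (PField n) q ∧
      g = gp - gq

lemma wtOf_add {n : ℕ} (B : Matrix (Fin n) (Fin n) ℤ) (a b : (Fin n ⊕ Fin n) →₀ ℕ) :
    wtOf B (a + b) = wtOf B a + wtOf B b := by
  ext i
  simp only [wtOf, Finsupp.add_apply, Pi.add_apply, Nat.cast_add, add_mul, Finset.sum_add_distrib]
  ring

lemma IsHomogOfWt.mul {n : ℕ} {B : Matrix (Fin n) (Fin n) ℤ} {g h : Fin n → ℤ}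
    {p q : MvPolynomial (Fin n ⊕ Fin n) ℚ} (hp : IsHomogOfWt B g p) (hq : IsHomogOfWt B h q) :
    IsHomogOfWt B (g + h) (p * q) := by
  classical
  intro m hm
  obtain ⟨a, ha, b, hb, rfl⟩ := Finset.mem_add.mp (MvPolynomial.support_mul p q hm)
  rw [wtOf_add, hp a ha, hq b hb]

lemma IsHomogOfWt.add {n : ℕ} {B : Matrix (Fin n) (Fin n) ℤ} {g : Fin n → ℤ}
    {p q : MvPolynomial (Fin n ⊕ Fin n) ℚ} (hp : IsHomogOfWt B g p) (hq : IsHomogOfWt B g q) :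
    IsHomogOfWt B g (p + q) := by
  classical
  intro m hm
  rcases Finset.mem_union.mp (MvPolynomial.support_add hm) with h | h
  · exact hp m h
  · exact hq m h

lemma ne_zero_of_eval_pos {n : ℕ} {p : MvPolynomial (Fin n ⊕ Fin n) ℚ}
    (h : 0 < eval (fun _ => (1 : ℚ)) p) : p ≠ 0 := by
  rintro rfl; simp at h

lemma algMap_ne_zero {n : ℕ} {p : MvPolynomial (Fin n ⊕ Fin n) ℚ} (h : p ≠ 0) :
    algebraMap (MvPolynomial (Fin n ⊕ Fin n) ℚ) (PField n) p ≠ 0 := by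
  intro h0
  exact h ((IsFractionRing.injective (MvPolynomial (Fin n ⊕ Fin n) ℚ) (PField n))
    (by rw [h0, map_zero]))

lemma PosG.mul {n : ℕ} {B : Matrix (Fin n) (Fin n) ℤ} {g h : Fin n → ℤ} {y z : PField n}
    (hy : PosG B g y) (hz : PosG B h z) : PosG B (g + h) (y * z) := by
  obtain ⟨p, q, gp, gq, h1, h2, h3, h4, rfl, rfl⟩ := hy
  obtain ⟨p', q', gp', gq', h1', h2', h3', h4', rfl, rfl⟩ := hz
  refine ⟨p * p', q * q', gp + gp', gq + gq', h1.mul h1', h2.mul h2', ?_, ?_, ?_, ?_⟩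
  · rw [map_mul]; positivity
  · rw [map_mul]; positivity
  · rw [map_mul, map_mul, div_mul_div_comm]
  · abel

lemma PosG.inv {n : ℕ} {B : Matrix (Fin n) (Fin n) ℤ} {g : Fin n → ℤ} {y : PField n}
    (hy : PosG B g y) : PosG B (-g) y⁻¹ := by
  obtain ⟨p, q, gp, gq, h1, h2, h3, h4, rfl, rfl⟩ := hy
  exact ⟨q, p, gq, gp, h2, h1, h4, h3, by rw [inv_div], by abel⟩

lemma PosG.add {n : ℕ} {B : Matrix (Fin n) (Fin n) ℤ} {g : Fin n → ℤ} {y z : PField n}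
    (hy : PosG B g y) (hz : PosG B g z) : PosG B g (y + z) := by
  obtain ⟨p, q, gp, gq, h1, h2, h3, h4, rfl, rfl⟩ := hy
  obtain ⟨p', q', gp', gq', h1', h2', h3', h4', rfl, h5⟩ := hz
  refine ⟨p * q' + q * p', q * q', gp + gq', gq + gq', (h1.mul h2').add ?_, h2.mul h2', ?_, ?_, ?_,
    ?_⟩
  · have : gp + gq' = gq + gp' := by
      have h6 : gp = gp' - gq' + gq := by rw [← h5]; abel
      rw [h6]; abel
    rw [this]; exact h2.mul h1'
  · rw [map_add, map_mul, map_mul]; positivity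
  · rw [map_mul]; positivity
  · rw [map_add, map_mul, map_mul, map_mul, div_add_div _ _
      (algMap_ne_zero (ne_zero_of_eval_pos h4)) (algMap_ne_zero (ne_zero_of_eval_pos h4'))]
  · abel

lemma PosG.one {n : ℕ} (B : Matrix (Fin n) (Fin n) ℤ) : PosG B 0 (1 : PField n) := by
  have h : IsHomogOfWt B 0 (1 : MvPolynomial (Fin n ⊕ Fin n) ℚ) := by
    intro m hm
    have : m = 0 := by
      by_contra hne
      rw [MvPolynomial.mem_support_iff, MvPolynomial.coeff_one, if_neg (Ne.symm hne)] at hm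
      exact hm rfl
    subst this
    ext i; simp [wtOf]
  exact ⟨1, 1, 0, 0, h, h, by simp, by simp, by simp, by simp⟩

lemma PosG.pow {n : ℕ} {B : Matrix (Fin n) (Fin n) ℤ} {g : Fin n → ℤ} {y : PField n}
    (hy : PosG B g y) (m : ℕ) : PosG B ((m : ℤ) • g) (y ^ m) := by
  induction m with
  | zero => simpa using PosG.one B
  | succ m ih =>
    rw [pow_succ]
    have := ih.mul hy
    convert this using 1
    push_cast; rw [add_smul, one_smul]

lemma PosG.prod {n : ℕ} {B : Matrix (Fin n) (Fin n) ℤ} {ι : Type*} (s : Finset ι)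
    (g : ι → Fin n → ℤ) (y : ι → PField n)
    (hy : ∀ i, PosG B (g i) (y i)) : PosG B (∑ i ∈ s, g i) (∏ i ∈ s, y i) := by
  classical
  induction s using Finset.induction_on with
  | empty => simpa using PosG.one B
  | insert a s ha ih => rw [Finset.sum_insert ha, Finset.prod_insert ha]; exact (hy a).mul ih

lemma PosG.var {n : ℕ} (B : Matrix (Fin n) (Fin n) ℤ) (x : Fin n ⊕ Fin n) :
    PosG B (wtOf B (Finsupp.single x 1)) (xVar n x) := by
  obtain ⟨p, q, gp, gq, h1, h2, h3, h4, h5, h6⟩ := PosG.one B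
  have hX : IsHomogOfWt B (wtOf B (Finsupp.single x 1)) (X x : MvPolynomial (Fin n ⊕ Fin n) ℚ) := by
    intro m hm
    rw [MvPolynomial.support_X, Finset.mem_singleton] at hm
    rw [hm]
  have hone : IsHomogOfWt B 0 (1 : MvPolynomial (Fin n ⊕ Fin n) ℚ) := by
    intro m hm
    have : m = 0 := by
      by_contra hne
      rw [MvPolynomial.mem_support_iff, MvPolynomial.coeff_one, if_neg (Ne.symm hne)] at hm
      exact hm rfl
    subst this
    ext i; simp [wtOf]
  exact ⟨X x, 1, _, 0, hX, hone, by simp, by simp, by simp [xVar], by simp⟩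

lemma PosG.unique {n : ℕ} {B : Matrix (Fin n) (Fin n) ℤ} {g h : Fin n → ℤ} {y : PField n}
    (hy : PosG B g y) (hz : HasGVector B h y) : h = g := by
  obtain ⟨p, q, gp, gq, h1, h2, h3, h4, h5, rfl⟩ := hy
  obtain ⟨p', q', gp', gq', h1', h2', h3', h4', rfl⟩ := hz
  have hq := ne_zero_of_eval_pos h4
  have hp := ne_zero_of_eval_pos h3
  have heq : p * q' = p' * q := by
    apply IsFractionRing.injective (MvPolynomial (Fin n ⊕ Fin n) ℚ) (PField n)
    rw [map_mul, map_mul]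
    rw [h5] at h4'
    exact (div_eq_div_iff (algMap_ne_zero hq) (algMap_ne_zero h3')).mp h4'
  have hne : p * q' ≠ 0 := mul_ne_zero hp h3'
  obtain ⟨m, hm⟩ := MvPolynomial.support_nonempty.mpr hne
  have e1 := (h1.mul h2') m hm
  rw [heq] at hm
  have e2 := (h1'.mul h2) m hm
  rw [e1] at e2
  have : gp' = gp + gq' - gq := by rw [e2]; abel
  rw [this]; abel

/-- Seeds along a path. -/
def seedP {n : ℕ} (B : Matrix (Fin n) (Fin n) ℤ) (ls : List (Fin n)) :
    Matrix (Fin n ⊕ Fin n) (Fin n) ℤ × (Fin n → PField n) :=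
  ls.foldl (fun s k' => mutSeedP k' s) (initSeedP n B)

lemma seedP_append {n : ℕ} (B : Matrix (Fin n) (Fin n) ℤ) (ls : List (Fin n)) (k : Fin n) :
    seedP B (ls ++ [k]) = mutSeedP k (seedP B ls) := by simp [seedP]

lemma seedP_mat {n : ℕ} (B : Matrix (Fin n) (Fin n) ℤ) (ls : List (Fin n)) :
    (∀ i j, (seedP B ls).1 (Sum.inl i) j = Bp B ls i j) ∧
    (∀ i j, (seedP B ls).1 (Sum.inr i) j = Cp B 1 ls i j) := by
  induction ls using List.reverseRecOn with
  | nil =>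
    refine ⟨fun i j => rfl, fun i j => ?_⟩
    simp [seedP, initSeedP, extMat, Cp, Matrix.one_apply]
  | append_singleton ls k ih =>
    obtain ⟨h1, h2⟩ := ih
    rw [seedP_append, Bp_append, Cp_append]
    refine ⟨fun i j => ?_, fun i j => ?_⟩
    · simp only [mutSeedP, mutMatExt, mutMat, h1, Sum.inl.injEq]
    · simp only [mutSeedP, mutMatExt, mutC, h1, h2, reduceCtorEq, false_or]

lemma gmat_data {n : ℕ} {d : Fin n → ℤ} (hd : ∀ i, 0 < d i)
    {B : Matrix (Fin n) (Fin n) ℤ} (h : SkD d B) (hs : SC B) (ls : List (Fin n)) :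
    ∃ G : Matrix (Fin n) (Fin n) ℤ,
      Gᵀ * Matrix.diagonal d * Cp B 1 ls = Matrix.diagonal d ∧
      G * Bp B ls = B * Cp B 1 ls ∧
      ∀ l, PosG B (fun i => G i l) ((seedP B ls).2 l) := by
  induction ls using List.reverseRecOn with
  | nil =>
    refine ⟨1, by simp [Cp], by simp [Cp, Bp], fun l => ?_⟩
    have := PosG.var B (Sum.inl l)
    convert this using 1
    ext i
    simp [wtOf, Matrix.one_apply, Finsupp.single_apply, eq_comm]
    rfl
  | append_singleton ls k ih =>
    obtain ⟨G, hG, hGB, hpos⟩ := ih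
    obtain ⟨e, he⟩ := hs ls k
    have hB := h.bp hd ls
    have hkk := hB.diag hd k
    obtain ⟨hm1, hm2⟩ := seedP_mat B ls
    obtain ⟨-, -, Ci, -, hCi, -, hcong⟩ := cmat_data hd h hs (ls ++ [k])
    have hGnew : (G * Fm k e (Bp B ls))ᵀ * Matrix.diagonal d * Cp B 1 (ls ++ [k])
        = Matrix.diagonal d := by
      rw [Cp_append, mutC_eq k e _ _ he]
      calc (G * Fm k e (Bp B ls))ᵀ * Matrix.diagonal d * (Cp B 1 ls * Em k e (Bp B ls))
          = (Fm k e (Bp B ls))ᵀ * (Gᵀ * Matrix.diagonal d * Cp B 1 ls) * Em k e (Bp B ls) := by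
            simp only [Matrix.mul_assoc, Matrix.transpose_mul]
        _ = Matrix.diagonal d * (Em k e (Bp B ls) * Em k e (Bp B ls)) := by
            rw [hG, ← diag_mul_Em hd hB k e, Matrix.mul_assoc]
        _ = _ := by rw [Em_mul_Em, Matrix.mul_one]
    refine ⟨G * Fm k e (Bp B ls), hGnew, ?_, fun l => ?_⟩
    · set C := Cp B 1 (ls ++ [k])
      set G' := G * Fm k e (Bp B ls)
      have h1 : Cᵀ * Matrix.diagonal d * G' = Matrix.diagonal d := by
        have := congrArg Matrix.transpose hGnew
        simpa [Matrix.transpose_mul, Matrix.mul_assoc] using this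
      have h2 : Cᵀ * (Matrix.diagonal d * (G' * Bp B (ls ++ [k])))
          = Cᵀ * (Matrix.diagonal d * (B * C)) := by
        calc _ = Cᵀ * Matrix.diagonal d * G' * Bp B (ls ++ [k]) := by simp only [Matrix.mul_assoc]
          _ = Cᵀ * (Matrix.diagonal d * B) * C := by rw [h1, hcong]
          _ = _ := by simp only [Matrix.mul_assoc]
      have h3 : Ciᵀ * Cᵀ = 1 := by rw [← Matrix.transpose_mul, hCi, Matrix.transpose_one]
      have h4 : Matrix.diagonal d * (G' * Bp B (ls ++ [k])) = Matrix.diagonal d * (B * C) := by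
        have := congrArg (Ciᵀ * ·) h2
        simpa only [← Matrix.mul_assoc Ciᵀ, h3, Matrix.one_mul] using this
      ext i j
      have h5 := congrFun (congrFun h4 i) j
      rw [Matrix.diagonal_mul, Matrix.diagonal_mul] at h5
      exact mul_left_cancel₀ (hd i).ne' h5
    · rw [seedP_append]
      by_cases hl : l = k
      · subst hl
        simp only [mutSeedP, Function.update_self, hm1, hm2]
        have hmono : ∀ f : ℤ → ℤ, PosG B (fun i => ∑ x, max (f (Bp B ls x l)) 0 * G i x
              - ∑ x, max (f (Cp B 1 ls x l)) 0 * B i x)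
            ((∏ i, (seedP B ls).2 i ^ (f (Bp B ls i l)).toNat) *
              ∏ j, xVar n (Sum.inr j) ^ (f (Cp B 1 ls j l)).toNat) := by
          intro f
          have h1 := PosG.prod Finset.univ _ _
            (fun i => (hpos i).pow (f (Bp B ls i l)).toNat)
          have h2 := PosG.prod Finset.univ _ _
            (fun j => (PosG.var B (Sum.inr j)).pow (f (Cp B 1 ls j l)).toNat)
          convert h1.mul h2 using 1
          ext i
          simp only [Pi.add_apply, Finset.sum_apply, Pi.smul_apply, smul_eq_mul, wtOf, sub_eq_add_neg,
            Int.ofNat_toNat, ← Finset.sum_neg_distrib]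
          congr 1
          apply Finset.sum_congr rfl
          intro x _
          simp [Finsupp.single_apply]
        have h1 := hmono id
        have h2 := hmono (fun x => -x)
        simp only [id] at h1
        have hdeg : ∀ i, ∑ x, max (Bp B ls x l) 0 * G i x - ∑ x, max (Cp B 1 ls x l) 0 * B i x
            = ∑ x, max (-Bp B ls x l) 0 * G i x - ∑ x, max (-Cp B 1 ls x l) 0 * B i x := by
          intro i
          have h5 := congrFun (congrFun hGB i) l
          rw [Matrix.mul_apply, Matrix.mul_apply] at h5
          have pn : ∀ x : ℤ, max x 0 - max (-x) 0 = x := by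
            intro x
            rcases max_zero_cases x with ⟨h1, h2⟩ | ⟨h1, h2⟩ <;>
            rcases max_zero_cases (-x) with ⟨h3, h4⟩ | ⟨h3, h4⟩ <;> omega
          have e1 : ∑ x, max (Bp B ls x l) 0 * G i x - ∑ x, max (-Bp B ls x l) 0 * G i x
              = ∑ x, G i x * Bp B ls x l := by
            rw [← Finset.sum_sub_distrib]
            apply Finset.sum_congr rfl
            intro x _
            rw [← sub_mul, pn, mul_comm]
          have e2 : ∑ x, max (Cp B 1 ls x l) 0 * B i x - ∑ x, max (-Cp B 1 ls x l) 0 * B i x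
              = ∑ x, B i x * Cp B 1 ls x l := by
            rw [← Finset.sum_sub_distrib]
            apply Finset.sum_congr rfl
            intro x _
            rw [← sub_mul, pn, mul_comm]
          linarith
        rw [funext hdeg] at h1
        have h3 := (h1.add h2).mul (hpos l).inv
        rw [← div_eq_mul_inv] at h3
        convert h3 using 1
        ext i
        rw [mul_Fm_apply, if_pos rfl]
        have herase : ∀ f : Fin n → ℤ, (f l = 0) →
            ∑ x ∈ Finset.univ.erase l, f x = ∑ x, f x := by
          intro f hf
          rw [← Finset.add_sum_erase _ _ (Finset.mem_univ l), hf, zero_add]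
        rw [herase _ (by simp [hkk])]
        simp only [Pi.add_apply, Pi.neg_apply]
        obtain ⟨he | he, hsg⟩ := he
        · subst he
          have h0 : ∑ x, max (-Cp B 1 ls x l) 0 * B i x = 0 := by
            apply Finset.sum_eq_zero
            intro x _
            have := hsg x
            rw [max_eq_right (by omega), zero_mul]
          rw [h0]
          simp only [neg_mul, one_mul, mul_comm (G i _)]
          ring
        · subst he
          have h0 : ∑ x, max (Cp B 1 ls x l) 0 * B i x = 0 := by
            apply Finset.sum_eq_zero
            intro x _
            have := hsg x
            rw [max_eq_right (by omega), zero_mul]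
          rw [← hdeg, h0]
          simp only [neg_neg, one_mul, mul_comm (G i _)]
          ring
      · have : (mutSeedP k (seedP B ls)).2 l = (seedP B ls).2 l := by
          simp [mutSeedP, hl]
        rw [this]
        convert hpos l using 1
        ext i
        rw [mul_Fm_apply, if_neg hl]

/-- The recurrence, for a mutation- and negation-closed class of sign-coherent matrices. -/
theorem recurrence_of_class {n : ℕ} {d : Fin n → ℤ} (hd : ∀ i, 0 < d i)
    (K : Matrix (Fin n) (Fin n) ℤ → Prop)
    (hKm : ∀ B k, K B → K (mutMat k B)) (hKn : ∀ B, K B → K (-B))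
    (hKs : ∀ B, K B → SC B)
    (B : Matrix (Fin n) (Fin n) ℤ) (hB : K B) (hdB : SkD d B)
    (k : Fin n) (ks : List (Fin n)) (l : Fin n) (g g' : Fin n → ℤ)
    (hg : HasGVector B g ((seedP B ks).2 l))
    (hg' : HasGVector (mutMat k B) g' ((seedP (mutMat k B) (k :: ks)).2 l)) :
    g' k = -g k ∧
      ∀ j, j ≠ k → g' j = g j + max (B j k) 0 * g k - B j k * min (g k) 0 := by
  have hKp : ∀ ls B, K B → K (Bp B ls) := by
    intro ls
    induction ls with
    | nil => intro B h; exact h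
    | cons k ls ih => intro B h; exact ih _ (hKm _ _ h)
  have hH : ∀ ls, HH B ls := fun ls =>
    duality hd K hKm hKn hKs ls.length B ls hB hdB le_rfl
  obtain ⟨G, hG, -, hGp⟩ := gmat_data hd hdB (hKs _ hB) ks
  obtain ⟨G', hG', -, hGp'⟩ := gmat_data hd (hdB.mut hd k) (hKs _ (hKm _ k hB)) (k :: ks)
  have e1 := (hGp l).unique hg
  have e2 := (hGp' l).unique hg'
  obtain ⟨η, hη, hC⟩ := left_mutation hd hdB (hKs _ hB) k (hKs _ (hKm _ k hB))
    (fun ls => hKs _ (hKn _ (hKp ls _ hB))) ks (fun ls _ => hH ls)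
  have hH1 := hH ks
  unfold HH at hH1
  set C := Cp B 1 ks with hCdef
  set Ci := Cp (-Bp B ks) 1 ks.reverse with hCidef
  rw [hC] at hG'
  -- relation between the two G-matrices
  have hDG : Gᵀ * Matrix.diagonal d = Matrix.diagonal d * Ci := by
    have := congrArg (· * Ci) hG
    simpa only [Matrix.mul_assoc, hH1, Matrix.mul_one] using this
  have hrel : G' = Fm k (-η) B * G := by
    have h1 : (G')ᵀ * Matrix.diagonal d = Matrix.diagonal d * Ci * Em k (-η) B := by
      have h2 := congrArg (· * (Ci * Em k (-η) B)) hG'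
      have h3 : Em k (-η) B * C * (Ci * Em k (-η) B) = 1 := by
        calc _ = Em k (-η) B * (C * Ci) * Em k (-η) B := by simp only [Matrix.mul_assoc]
          _ = 1 := by rw [hH1, Matrix.mul_one, Em_mul_Em]
      simpa only [Matrix.mul_assoc _ (Em k (-η) B * C), h3, Matrix.mul_one,
        ← Matrix.mul_assoc (Matrix.diagonal d)] using h2
    rw [← hDG, Matrix.mul_assoc, diag_mul_Em hd hdB k (-η)] at h1
    have h2 := congrArg Matrix.transpose h1
    simp only [Matrix.transpose_mul, Matrix.transpose_transpose, Matrix.diagonal_transpose] at h2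
    ext i j
    have h3 := congrFun (congrFun h2 i) j
    rw [Matrix.mul_assoc, Matrix.diagonal_mul, Matrix.diagonal_mul] at h3
    exact mul_left_cancel₀ (hd i).ne' h3
  have hsign : 0 ≤ η * g k := by
    have h1 := congrFun (congrFun hDG l) k
    rw [Matrix.mul_diagonal, Matrix.diagonal_mul, Matrix.transpose_apply] at h1
    have h2 := hη.2 l
    have h3 : 0 ≤ (η * G k l) * d k := by
      calc 0 ≤ d l * (η * Ci l k) := mul_nonneg (hd l).le h2
        _ = (η * G k l) * d k := by rw [mul_assoc, h1]; ring
    rw [e1]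
    exact nonneg_of_mul_nonneg_left h3 (hd k)
  have hval : ∀ j, g' j = if j = k then -g k else g j + max (η * B j k) 0 * g k := by
    intro j
    have h9 := Fm_mul_apply k (-η) B G j l
    rw [neg_neg] at h9
    rw [e1, e2, hrel]
    exact h9
  refine ⟨by rw [hval, if_pos rfl], fun j hj => ?_⟩
  rw [hval, if_neg hj]
  rcases hη.1 with h1 | h1 <;> subst h1
  · rw [min_eq_right (by omega)]; simp
  · rw [min_eq_left (by omega)]
    rcases max_zero_cases (B j k) with ⟨h3, h4⟩ | ⟨h3, h4⟩
    · rw [h4, max_eq_right (by omega)]; ring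
    · rw [h4, max_eq_left (by omega)]; ring

/-! ### Labelled binary trees (centrally symmetric triangulations) -/

/-- Kronecker delta. -/
def dl {X : Type*} [DecidableEq X] (x y : X) : ℤ := if x = y then 1 else 0

/-- The signed incidence function of an oriented triangle `a, l, r`. -/
def tau {X : Type*} [DecidableEq X] (a l r x y : X) : ℤ :=
  dl x a * dl y l + dl x l * dl y r + dl x r * dl y a
    - dl x l * dl y a - dl x r * dl y l - dl x a * dl y r

lemma tau_anti {X : Type*} [DecidableEq X] (a l r x y : X) :
    tau a l r x y = -tau a l r y x := by unfold tau; ring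

lemma tau_swap {X : Type*} [DecidableEq X] (a l r x y : X) :
    tau a r l x y = -tau a l r x y := by unfold tau; ring

lemma tau_eq_zero {X : Type*} [DecidableEq X] {a l r x y : X} (h1 : y ≠ a) (h2 : y ≠ l)
    (h3 : y ≠ r) : tau a l r x y = 0 := by simp [tau, dl, h1, h2, h3]

lemma tau_flip_col {X : Type*} [DecidableEq X] {p q A B C : X} (h1 : q ≠ p) (h2 : q ≠ A)
    (h3 : q ≠ B) (h4 : q ≠ C) (x : X) :
    tau p A q x q + tau q B C x q = -(tau p q C x q + tau q A B x q) := by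
  simp [tau, dl, h1, h2, h3, h4]; ring

lemma tau_col_left {X : Type*} [DecidableEq X] {p q A B C : X} (h1 : q ≠ p) (h2 : q ≠ A)
    (h3 : q ≠ B) (h4 : q ≠ C) (x : X) :
    tau p q C x q + tau q A B x q = dl x B - dl x A + dl x p - dl x C := by
  simp [tau, dl, h1, h2, h3, h4]; ring

lemma dl_cases {X : Type*} [DecidableEq X] {p A B C : X} (h5 : p ≠ A) (h6 : p ≠ B) (h7 : p ≠ C)
    (h8 : A ≠ B) (h9 : A ≠ C) (h10 : B ≠ C) (x : X) :
    (dl x p = 1 ∧ dl x A = 0 ∧ dl x B = 0 ∧ dl x C = 0) ∨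
    (dl x p = 0 ∧ dl x A = 1 ∧ dl x B = 0 ∧ dl x C = 0) ∨
    (dl x p = 0 ∧ dl x A = 0 ∧ dl x B = 1 ∧ dl x C = 0) ∨
    (dl x p = 0 ∧ dl x A = 0 ∧ dl x B = 0 ∧ dl x C = 1) ∨
    (dl x p = 0 ∧ dl x A = 0 ∧ dl x B = 0 ∧ dl x C = 0) := by
  unfold dl
  by_cases e1 : x = p
  · subst e1; simp [h5, h6, h7]
  by_cases e2 : x = A
  · subst e2; simp [h5.symm, h8, h9]
  by_cases e3 : x = B
  · subst e3; simp [h6.symm, h8.symm, h10]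
  by_cases e4 : x = C
  · subst e4; simp [h7.symm, h9.symm, h10.symm]
  simp [e1, e2, e3, e4]

lemma tau_flip {X : Type*} [DecidableEq X] {p q A B C : X}
    (h5 : p ≠ A) (h6 : p ≠ B) (h7 : p ≠ C) (h8 : A ≠ B) (h9 : A ≠ C)
    (h10 : B ≠ C) {x y : X} (hx : x ≠ q) (hy : y ≠ q) :
    tau p A q x y + tau q B C x y - (tau p q C x y + tau q A B x y) =
      (dl x B - dl x A + dl x p - dl x C).sign *
        max ((dl x B - dl x A + dl x p - dl x C) * -(dl y B - dl y A + dl y p - dl y C)) 0 := by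
  have ex : dl x q = 0 := if_neg hx
  have ey : dl y q = 0 := if_neg hy
  unfold tau
  rw [ex, ey]
  rcases dl_cases h5 h6 h7 h8 h9 h10 x with ⟨a1, a2, a3, a4⟩ | ⟨a1, a2, a3, a4⟩ | ⟨a1, a2, a3, a4⟩ |
      ⟨a1, a2, a3, a4⟩ | ⟨a1, a2, a3, a4⟩ <;>
    rcases dl_cases h5 h6 h7 h8 h9 h10 y with ⟨b1, b2, b3, b4⟩ | ⟨b1, b2, b3, b4⟩ |
      ⟨b1, b2, b3, b4⟩ | ⟨b1, b2, b3, b4⟩ | ⟨b1, b2, b3, b4⟩ <;>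
    simp [a1, a2, a3, a4, b1, b2, b3, b4]

lemma tau_flip_inv {X : Type*} [DecidableEq X] {p q A B C : X}
    (h5 : p ≠ A) (h6 : p ≠ B) (h7 : p ≠ C) (h8 : A ≠ B) (h9 : A ≠ C)
    (h10 : B ≠ C) {x y : X} (hx : x ≠ q) (hy : y ≠ q) :
    tau p q C x y + tau q A B x y - (tau p A q x y + tau q B C x y) =
      (-(dl x B - dl x A + dl x p - dl x C)).sign *
        max (-(dl x B - dl x A + dl x p - dl x C) * (dl y B - dl y A + dl y p - dl y C)) 0 := by
  have := tau_flip h5 h6 h7 h8 h9 h10 hx hy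
  rw [Int.sign_neg, neg_mul (dl x B - dl x A + dl x p - dl x C), ← mul_neg (dl x B - dl x A + dl x p - dl x C), neg_mul, ← this]
  ring

/-- Edge labels: nodes and leaves. -/
abbrev XX (n : ℕ) := Fin n ⊕ (Bool × Fin n)

/-- A labelled plane binary tree, drawn on the integer line. -/
structure Tri (n : ℕ) where
  /-- the root -/
  ρ : Fin n
  /-- children -/
  ch : Bool × Fin n → XX n
  /-- left end point -/
  st : XX n → ℤ
  /-- right end point -/
  en : XX n → ℤ
  /-- length of the root -/
  M : ℤ
  inj : Function.Injective ch
  ne_root : ∀ s, ch s ≠ Sum.inl ρ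
  cov : ∀ i, i ≠ ρ → ∃ s, ch s = Sum.inl i
  hl : ∀ m, st (ch (false, m)) = st (Sum.inl m)
  hm : ∀ m, en (ch (false, m)) = st (ch (true, m))
  hr : ∀ m, en (ch (true, m)) = en (Sum.inl m)
  lt : ∀ x, st x < en x
  per : en (Sum.inl ρ) = st (Sum.inl ρ) + M

namespace Tri

variable {n : ℕ} (T : Tri n)

/-- The skew-symmetric adjacency function. -/
def t (x y : XX n) : ℤ := ∑ m, tau (Sum.inl m) (T.ch (false, m)) (T.ch (true, m)) x y

/-- Column weights. -/
def dd (j : Fin n) : ℤ := if j = T.ρ then 2 else 1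

/-- The extended exchange matrix. -/
def b (x : XX n) (j : Fin n) : ℤ := T.t x (Sum.inl j) * T.dd j

/-- The exchange matrix. -/
def mat : Matrix (Fin n) (Fin n) ℤ := fun i j => T.b (Sum.inl i) j

lemma t_anti (x y : XX n) : T.t x y = -T.t y x := by
  unfold t; rw [← Finset.sum_neg_distrib]
  exact Finset.sum_congr rfl fun m _ => tau_anti _ _ _ _ _

lemma t_diag (x : XX n) : T.t x x = 0 := by have := T.t_anti x x; omega

lemma dd_pos (j : Fin n) : 0 < T.dd j := by unfold dd; split_ifs <;> norm_num

lemma ne_self (s : Bool × Fin n) : T.ch s ≠ Sum.inl s.2 := by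
  rcases s with ⟨b, m⟩
  intro h
  have h1 := T.hl m
  have h2 := T.hm m
  have h3 := T.hr m
  have h4 := T.lt (T.ch (false, m))
  have h5 := T.lt (T.ch (true, m))
  cases b
  · rw [h] at h2; rw [← h2] at h5; simp only [] at h5; omega
  · rw [h] at h2; simp only [] at h2; omega

lemma ch_st_le (s : Bool × Fin n) : T.st (Sum.inl s.2) ≤ T.st (T.ch s) ∧
    T.en (T.ch s) ≤ T.en (Sum.inl s.2) ∧
    T.en (T.ch s) - T.st (T.ch s) < T.en (Sum.inl s.2) - T.st (Sum.inl s.2) := by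
  rcases s with ⟨b, m⟩
  have h1 := T.hl m
  have h2 := T.hm m
  have h3 := T.hr m
  have h4 := T.lt (T.ch (false, m))
  have h5 := T.lt (T.ch (true, m))
  cases b <;> simp only [] <;> omega

lemma ch_ne_ch {s s' : Bool × Fin n} (h : s ≠ s') : T.ch s ≠ T.ch s' := fun e => h (T.inj e)

/-- If `k` is a child of `j` then `j` is not a child of `k`. -/
lemma ch_ne_par {b : Bool} {j k : Fin n} (h : T.ch (b, j) = Sum.inl k) (b' : Bool) :
    T.ch (b', k) ≠ Sum.inl j := by
  intro h'
  have h1 := (T.ch_st_le (b, j)).2.2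
  have h2 := (T.ch_st_le (b', k)).2.2
  rw [h] at h1
  rw [h'] at h2
  simp only [] at h1 h2
  omega

lemma node_ind {P : Fin n → Prop} (h0 : P T.ρ)
    (hs : ∀ s i, P s.2 → T.ch s = Sum.inl i → P i) : ∀ i, P i := by
  have key : ∀ N : ℕ, ∀ i, ((∑ x, (T.en x - T.st x)) - (T.en (Sum.inl i) - T.st (Sum.inl i))).toNat
      ≤ N → P i := by
    intro N
    induction N with
    | zero =>
      intro i hi
      by_cases hr : i = T.ρ
      · rw [hr]; exact h0
      · obtain ⟨s, hs'⟩ := T.cov i hr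
        have h1 := (T.ch_st_le s).2.2
        have h2 := Finset.single_le_sum (f := fun x => T.en x - T.st x)
          (fun x _ => by have := T.lt x; omega) (Finset.mem_univ (Sum.inl s.2 : XX n))
        rw [hs'] at h1
        omega
    | succ N ih =>
      intro i hi
      by_cases hr : i = T.ρ
      · rw [hr]; exact h0
      · obtain ⟨s, hs'⟩ := T.cov i hr
        have h1 := (T.ch_st_le s).2.2
        have h2 := Finset.single_le_sum (f := fun x => T.en x - T.st x)
          (fun x _ => by have := T.lt x; omega) (Finset.mem_univ (Sum.inl s.2 : XX n))
        rw [hs'] at h1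
        exact hs s i (ih _ (by omega)) hs'
  exact fun i => key _ i le_rfl

/-- Nodes other than the root avoid the middle of the root. -/
lemma mid_root (i : Fin n) : i = T.ρ ∨ T.en (Sum.inl i) ≤ T.st (T.ch (true, T.ρ)) ∨
    T.st (T.ch (true, T.ρ)) ≤ T.st (Sum.inl i) := by
  refine T.node_ind (P := fun i => i = T.ρ ∨ T.en (Sum.inl i) ≤ T.st (T.ch (true, T.ρ)) ∨
    T.st (T.ch (true, T.ρ)) ≤ T.st (Sum.inl i)) (Or.inl rfl) ?_ i
  rintro ⟨b, m⟩ i h1 h2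
  right
  rcases h1 with h1 | h1
  · simp only [] at h1
    subst h1
    cases b
    · left; rw [← h2, T.hm]
    · right; rw [← h2]
  · have := T.ch_st_le (b, m)
    rw [h2] at this
    simp only [] at this h1
    omega

lemma t_col_nonroot {b : Bool} {j k : Fin n} (h : T.ch (b, j) = Sum.inl k) (x : XX n) :
    T.t x (Sum.inl k) = tau (Sum.inl j) (T.ch (false, j)) (T.ch (true, j)) x (Sum.inl k) +
      tau (Sum.inl k) (T.ch (false, k)) (T.ch (true, k)) x (Sum.inl k) := by
  have hjk : j ≠ k := by rintro rfl; exact T.ne_self _ h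
  refine Fintype.sum_eq_add j k hjk fun m hm => tau_eq_zero ?_ ?_ ?_
  · simpa using hm.2.symm
  · rw [← h]; exact T.ch_ne_ch (by simp; intro _ h; exact hm.1 h.symm)
  · rw [← h]; exact T.ch_ne_ch (by simp; intro _ h; exact hm.1 h.symm)

lemma t_col_root (x : XX n) :
    T.t x (Sum.inl T.ρ) = dl x (T.ch (true, T.ρ)) - dl x (T.ch (false, T.ρ)) := by
  have : T.t x (Sum.inl T.ρ) =
      tau (Sum.inl T.ρ) (T.ch (false, T.ρ)) (T.ch (true, T.ρ)) x (Sum.inl T.ρ) := by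
    refine Fintype.sum_eq_single T.ρ fun m hm => tau_eq_zero ?_ ?_ ?_
    · simpa using hm.symm
    · exact (T.ne_root _).symm
    · exact (T.ne_root _).symm
  rw [this]
  have h1 := (T.ne_root (false, T.ρ)).symm
  have h2 := (T.ne_root (true, T.ρ)).symm
  simp [tau, dl, h1, h2]

lemma t_col_left {j k : Fin n} (h : T.ch (false, j) = Sum.inl k) (x : XX n) :
    T.t x (Sum.inl k) = dl x (T.ch (true, k)) - dl x (T.ch (false, k)) + dl x (Sum.inl j)
      - dl x (T.ch (true, j)) := by
  have hjk : j ≠ k := by rintro rfl; exact T.ne_self _ h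
  rw [T.t_col_nonroot h, h]
  refine tau_col_left ?_ (T.ne_self (false, k)).symm (T.ne_self (true, k)).symm ?_ x
  · simpa using hjk.symm
  · rw [← h]; exact T.ch_ne_ch (by simp)

lemma t_col_right {j k : Fin n} (h : T.ch (true, j) = Sum.inl k) (x : XX n) :
    T.t x (Sum.inl k) = -(dl x (T.ch (false, k)) - dl x (T.ch (false, j)) + dl x (Sum.inl j)
      - dl x (T.ch (true, k))) := by
  have hjk : j ≠ k := by rintro rfl; exact T.ne_self _ h
  have h1 : (Sum.inl k : XX n) ≠ Sum.inl j := by simpa using hjk.symm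
  have h2 := (T.ne_self (false, k)).symm
  have h3 := (T.ne_self (true, k)).symm
  have h4 : (Sum.inl k : XX n) ≠ T.ch (false, j) := by rw [← h]; exact T.ch_ne_ch (by simp)
  rw [T.t_col_nonroot h, h, tau_flip_col h1 h4 h2 h3, tau_col_left h1 h4 h2 h3]

end Tri

/-- Functions on arcs invariant under the central symmetry. -/
structure FInv (M : ℤ) (f : ℤ → ℤ → ℤ) : Prop where
  symm : ∀ u v, f u v = f v u
  sh : ∀ u v, f (u + M) (v + M) = f u v
  per : ∀ u v, f (u + 2 * M) v = f u v

/-- `T'` is the flip of `T` at `k`, inside the quadrilateral `a, b, c, d`. -/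
structure FlipData {n : ℕ} (T T' : Tri n) (k : Fin n) (a b c d : ℤ) : Prop where
  hM : T'.M = T.M
  hab : a < b
  hbc : b < c
  hcd : c < d
  hda : d < a + 2 * T.M
  hb : ∀ x j, T'.b x j = if x = Sum.inl k ∨ j = k then -T.b x j
    else T.b x j + (T.b x k).sign * max (T.b x k * T.b (Sum.inl k) j) 0
  hw : ∀ f, FInv T.M f → ∀ x, x ≠ Sum.inl k → f (T'.st x) (T'.en x) = f (T.st x) (T.en x)
  hk : ∀ f, FInv T.M f → f (T'.st (Sum.inl k)) (T'.en (Sum.inl k)) +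
    f (T.st (Sum.inl k)) (T.en (Sum.inl k)) = f a c + f b d
  hs : (∀ f, FInv T.M f → ∑ x, max (T.b x k) 0 * f (T.st x) (T.en x) = f a b + f c d ∧
      ∑ x, max (-T.b x k) 0 * f (T.st x) (T.en x) = f b c + f a d) ∨
    (∀ f, FInv T.M f → ∑ x, max (T.b x k) 0 * f (T.st x) (T.en x) = f b c + f a d ∧
      ∑ x, max (-T.b x k) 0 * f (T.st x) (T.en x) = f a b + f c d)

lemma sum_dl_mul {X : Type*} [DecidableEq X] [Fintype X] (a : X) (w : X → ℤ) :
    ∑ x, dl x a * w x = w a := by simp [dl]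

lemma sum_pos_part {X : Type*} [DecidableEq X] [Fintype X] {p A B C : X}
    (h5 : p ≠ A) (h6 : p ≠ B) (h7 : p ≠ C) (h8 : A ≠ B) (h9 : A ≠ C) (h10 : B ≠ C) (w : X → ℤ) :
    ∑ x, max (dl x B - dl x A + dl x p - dl x C) 0 * w x = w B + w p ∧
    ∑ x, max (-(dl x B - dl x A + dl x p - dl x C)) 0 * w x = w A + w C := by
  have e1 : ∀ x, max (dl x B - dl x A + dl x p - dl x C) 0 = dl x B + dl x p := by
    intro x
    rcases dl_cases h5 h6 h7 h8 h9 h10 x with ⟨a1, a2, a3, a4⟩ | ⟨a1, a2, a3, a4⟩ |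
      ⟨a1, a2, a3, a4⟩ | ⟨a1, a2, a3, a4⟩ | ⟨a1, a2, a3, a4⟩ <;> rw [a1, a2, a3, a4] <;> norm_num
  have e2 : ∀ x, max (-(dl x B - dl x A + dl x p - dl x C)) 0 = dl x A + dl x C := by
    intro x
    rcases dl_cases h5 h6 h7 h8 h9 h10 x with ⟨a1, a2, a3, a4⟩ | ⟨a1, a2, a3, a4⟩ |
      ⟨a1, a2, a3, a4⟩ | ⟨a1, a2, a3, a4⟩ | ⟨a1, a2, a3, a4⟩ <;> rw [a1, a2, a3, a4] <;> norm_num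
  simp only [e1, e2, add_mul, Finset.sum_add_distrib, sum_dl_mul, and_self]

namespace Tri

variable {n : ℕ} (T : Tri n)

lemma b_mut {T T' : Tri n} (hρ : T'.ρ = T.ρ) (k : Fin n)
    (h1 : ∀ x, T'.t x (Sum.inl k) = -T.t x (Sum.inl k))
    (h2 : ∀ x y, x ≠ Sum.inl k → y ≠ Sum.inl k → T'.t x y = T.t x y + (T.t x (Sum.inl k)).sign *
      max (T.t x (Sum.inl k) * T.t (Sum.inl k) y) 0 * T.dd k) (x : XX n) (j : Fin n) :
    T'.b x j = if x = Sum.inl k ∨ j = k then -T.b x j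
    else T.b x j + (T.b x k).sign * max (T.b x k * T.b (Sum.inl k) j) 0 := by
  have hd : T'.dd j = T.dd j := by unfold dd; rw [hρ]
  unfold b
  rw [hd]
  split_ifs with h
  · rcases h with h | h
    · rw [h, T'.t_anti, h1, T.t_anti (Sum.inl k)]; ring
    · rw [h, h1]; ring
  · push Not at h
    rw [h2 x (Sum.inl j) h.1 (by simpa using h.2)]
    have e1 : (T.t x (Sum.inl k) * T.dd k).sign = (T.t x (Sum.inl k)).sign := by
      rw [Int.sign_mul, Int.sign_eq_one_of_pos (T.dd_pos k), mul_one]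
    have e2 : max (T.t x (Sum.inl k) * T.dd k * (T.t (Sum.inl k) (Sum.inl j) * T.dd j)) 0 =
        (T.dd k * T.dd j) * max (T.t x (Sum.inl k) * T.t (Sum.inl k) (Sum.inl j)) 0 := by
      rw [← max_mul_of_pos _ _ (mul_pos (T.dd_pos k) (T.dd_pos j))]
      congr 1; ring
    rw [e1, e2]; ring

lemma M_pos : 0 < T.M := by have := T.lt (Sum.inl T.ρ); have := T.per; omega

lemma in_root (i : Fin n) : T.st (Sum.inl T.ρ) ≤ T.st (Sum.inl i) ∧
    T.en (Sum.inl i) ≤ T.en (Sum.inl T.ρ) := by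
  refine T.node_ind (P := fun i => T.st (Sum.inl T.ρ) ≤ T.st (Sum.inl i) ∧
    T.en (Sum.inl i) ≤ T.en (Sum.inl T.ρ)) ⟨le_rfl, le_rfl⟩ ?_ i
  intro s i h1 h2
  have := T.ch_st_le s
  rw [h2] at this
  omega

lemma exists_flip_root : ∃ T' : Tri n, ∃ a b c d, FlipData T T' T.ρ a b c d := by
  classical
  set r := T.st (T.ch (true, T.ρ)) with hr
  have hl1 := T.hl T.ρ
  have hl2 := T.hm T.ρ
  have hl3 := T.hr T.ρ
  have hl4 := T.lt (T.ch (false, T.ρ))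
  have hl5 := T.lt (T.ch (true, T.ρ))
  have hper := T.per
  have hLR : T.ch (true, T.ρ) ≠ T.ch (false, T.ρ) := T.ch_ne_ch (by simp)
  let π : Equiv.Perm (Bool × Fin n) := Equiv.swap (false, T.ρ) (true, T.ρ)
  have hπl : π (false, T.ρ) = (true, T.ρ) := Equiv.swap_apply_left _ _
  have hπr : π (true, T.ρ) = (false, T.ρ) := Equiv.swap_apply_right _ _
  have hπo : ∀ b m, m ≠ T.ρ → π (b, m) = (b, m) := by
    intro b m hm
    exact Equiv.swap_apply_of_ne_of_ne (by simp [hm]) (by simp [hm])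
  let st' : XX n → ℤ := fun x => if x = Sum.inl T.ρ then r else if T.st x < r then T.st x + T.M
    else T.st x
  let en' : XX n → ℤ := fun x => if x = Sum.inl T.ρ then r + T.M else if T.st x < r then T.en x + T.M
    else T.en x
  have hst : ∀ x, x ≠ Sum.inl T.ρ → T.st x < r → st' x = T.st x + T.M ∧ en' x = T.en x + T.M := by
    intro x h1 h2; simp only [st', en', if_neg h1, if_pos h2, and_self]
  have hst2 : ∀ x, x ≠ Sum.inl T.ρ → r ≤ T.st x → st' x = T.st x ∧ en' x = T.en x := by
    intro x h1 h2; simp only [st', en', if_neg h1, if_neg (not_lt.mpr h2), and_self]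
  have hst0 : st' (Sum.inl T.ρ) = r ∧ en' (Sum.inl T.ρ) = r + T.M := by simp [st', en']
  have hL := hst _ (T.ne_root (false, T.ρ)) (by omega)
  have hR := hst2 _ (T.ne_root (true, T.ρ)) (by omega)
  have hnode : ∀ m, m ≠ T.ρ → ∃ s, (s = 0 ∨ s = T.M) ∧ st' (Sum.inl m) = T.st (Sum.inl m) + s ∧
      en' (Sum.inl m) = T.en (Sum.inl m) + s ∧ ∀ b, st' (T.ch (b, m)) = T.st (T.ch (b, m)) + s ∧
      en' (T.ch (b, m)) = T.en (T.ch (b, m)) + s := by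
    intro m hm
    have hm' : (Sum.inl m : XX n) ≠ Sum.inl T.ρ := by simpa using hm
    have hlt := T.lt (Sum.inl m)
    rcases (T.mid_root m).resolve_left hm with h | h
    · refine ⟨T.M, Or.inr rfl, (hst _ hm' (by omega)).1, (hst _ hm' (by omega)).2, fun b => ?_⟩
      have h1 := T.ch_st_le (b, m)
      have h2 := T.lt (T.ch (b, m))
      simp only [] at h1
      exact hst _ (T.ne_root _) (by omega)
    · refine ⟨0, Or.inl rfl, ?_, ?_, fun b => ?_⟩
      · rw [(hst2 _ hm' (by omega)).1]; ring
      · rw [(hst2 _ hm' (by omega)).2]; ring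
      have h1 := T.ch_st_le (b, m)
      simp only [] at h1
      have := hst2 _ (T.ne_root (b, m)) (by omega)
      rw [this.1, this.2]; simp
  let T' : Tri n :=
    { ρ := T.ρ
      ch := T.ch ∘ π
      st := st'
      en := en'
      M := T.M
      inj := T.inj.comp π.injective
      ne_root := fun s => T.ne_root _
      cov := fun i hi => by
        obtain ⟨s, hs⟩ := T.cov i hi
        exact ⟨π.symm s, by simpa using hs⟩
      hl := fun m => by
        by_cases hm : m = T.ρ
        · subst hm; simp only [Function.comp, hπl]; omega
        · obtain ⟨s, _, h1, h2, h3⟩ := hnode m hm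
          have := T.hl m; have := h3 false
          simp only [Function.comp, hπo _ _ hm]; omega
      hm := fun m => by
        by_cases hm : m = T.ρ
        · subst hm; simp only [Function.comp, hπl, hπr]; omega
        · obtain ⟨s, _, h1, h2, h3⟩ := hnode m hm
          have := T.hm m; have := h3 false; have := h3 true
          simp only [Function.comp, hπo _ _ hm]; omega
      hr := fun m => by
        by_cases hm : m = T.ρ
        · subst hm; simp only [Function.comp, hπr]; omega
        · obtain ⟨s, _, h1, h2, h3⟩ := hnode m hm
          have := T.hr m; have := h3 true
          simp only [Function.comp, hπo _ _ hm]; omega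
      lt := fun x => by
        have := T.lt x
        have := T.M_pos
        simp only [st', en']; split_ifs <;> omega
      per := by rw [hst0.1, hst0.2] }
  have ht : ∀ x y, T'.t x y = T.t x y -
      2 * tau (Sum.inl T.ρ) (T.ch (false, T.ρ)) (T.ch (true, T.ρ)) x y := by
    intro x y
    have : T'.t x y - T.t x y =
      -2 * tau (Sum.inl T.ρ) (T.ch (false, T.ρ)) (T.ch (true, T.ρ)) x y := by
      unfold t
      rw [← Finset.sum_sub_distrib]
      rw [Fintype.sum_eq_single T.ρ]
      · simp only [T', Function.comp, hπl, hπr]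
        rw [tau_swap]; ring
      · intro m hm
        simp only [T', Function.comp, hπo _ _ hm]; ring
    linarith
  have hcol := T.t_col_root
  have hn1 := T.ne_root (false, T.ρ)
  have hn2 := T.ne_root (true, T.ρ)
  have hb : ∀ x, T.b x T.ρ = 2 * (dl x (T.ch (true, T.ρ)) - dl x (T.ch (false, T.ρ))) := by
    intro x; unfold b; rw [hcol]; simp [dd]; ring
  have hcase : ∀ x, (dl x (T.ch (true, T.ρ)) = 1 ∧ dl x (T.ch (false, T.ρ)) = 0) ∨
      (dl x (T.ch (true, T.ρ)) = 0 ∧ dl x (T.ch (false, T.ρ)) = 1) ∨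
      (dl x (T.ch (true, T.ρ)) = 0 ∧ dl x (T.ch (false, T.ρ)) = 0) := by
    intro x
    by_cases h1 : x = T.ch (true, T.ρ)
    · left; subst h1; simp [dl, hLR]
    · right
      by_cases h2 : x = T.ch (false, T.ρ)
      · left; subst h2; simp [dl, hLR.symm]
      · right; simp [dl, h1, h2]
  refine ⟨T', T.st (Sum.inl T.ρ), r, T.st (Sum.inl T.ρ) + T.M, r + T.M, rfl, by omega, by omega,
    by omega, by omega, b_mut (T := T) (T' := T') rfl T.ρ ?_ ?_, ?_, ?_, Or.inr ?_⟩
  · intro x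
    rw [ht, hcol]
    simp [tau, dl, hn1.symm, hn2.symm]; ring
  · intro x y hx hy
    rw [ht, hcol, T.t_anti (Sum.inl T.ρ) y, hcol]
    have e1 : dl x (Sum.inl T.ρ) = 0 := if_neg hx
    have e2 : dl y (Sum.inl T.ρ) = 0 := if_neg hy
    have e3 : T.dd T.ρ = 2 := if_pos rfl
    unfold tau
    rw [e1, e2, e3]
    rcases hcase x with ⟨a1, a2⟩ | ⟨a1, a2⟩ | ⟨a1, a2⟩ <;>
      rcases hcase y with ⟨b1, b2⟩ | ⟨b1, b2⟩ | ⟨b1, b2⟩ <;> rw [a1, a2, b1, b2] <;> simp <;> ring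
  · intro f hf x hx
    rcases lt_or_ge (T.st x) r with h | h
    · have := hst x hx h
      change f (st' x) (en' x) = _
      rw [this.1, this.2, hf.sh]
    · have := hst2 x hx h
      change f (st' x) (en' x) = _
      rw [this.1, this.2]
  · intro f hf
    change f (st' _) (en' _) + _ = _
    rw [hst0.1, hst0.2, hper]; ring
  · intro f hf
    have e1 : ∀ x, max (T.b x T.ρ) 0 = 2 * dl x (T.ch (true, T.ρ)) := by
      intro x; rw [hb]
      rcases hcase x with ⟨a1, a2⟩ | ⟨a1, a2⟩ | ⟨a1, a2⟩ <;> rw [a1, a2] <;> norm_num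
    have e2 : ∀ x, max (-T.b x T.ρ) 0 = 2 * dl x (T.ch (false, T.ρ)) := by
      intro x; rw [hb]
      rcases hcase x with ⟨a1, a2⟩ | ⟨a1, a2⟩ | ⟨a1, a2⟩ <;> rw [a1, a2] <;> norm_num
    simp only [e1, e2, mul_assoc, ← Finset.mul_sum, sum_dl_mul]
    rw [hl1, hl2, hl3, hper, ← hr, hf.sh]
    refine ⟨?_, by ring⟩
    have h1 : f (T.st (Sum.inl T.ρ)) (r + T.M) = f r (T.st (Sum.inl T.ρ) + T.M) := by
      rw [← hf.per (T.st (Sum.inl T.ρ)), hf.symm r, ← hf.sh _ r]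
      congr 1; ring
    rw [h1]; ring

lemma len_le (i : Fin n) : T.en (Sum.inl i) ≤ T.st (Sum.inl i) + T.M := by
  have := T.in_root i; have := T.per; omega

lemma exists_flip_left {j k : Fin n} (h : T.ch (false, j) = Sum.inl k) :
    ∃ T' : Tri n, ∃ a b c d, FlipData T T' k a b c d := by
  classical
  have hjk : j ≠ k := by rintro rfl; exact T.ne_self _ h
  have hkj : k ≠ j := hjk.symm
  have hkρ : k ≠ T.ρ := by rintro rfl; exact T.ne_root _ h
  have n1 : (Sum.inl k : XX n) ≠ Sum.inl j := by simpa using hkj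
  have n2 := (T.ne_self (false, k)).symm
  have n3 := (T.ne_self (true, k)).symm
  have n4 : (Sum.inl k : XX n) ≠ T.ch (true, j) := by rw [← h]; exact T.ch_ne_ch (by simp)
  have n5 := (T.ch_ne_par h false).symm
  have n6 := (T.ch_ne_par h true).symm
  have n7 := (T.ne_self (true, j)).symm
  have n8 : T.ch (false, k) ≠ T.ch (true, k) := T.ch_ne_ch (by simp)
  have n9 : T.ch (false, k) ≠ T.ch (true, j) := T.ch_ne_ch (by simp)
  have n10 : T.ch (true, k) ≠ T.ch (true, j) := T.ch_ne_ch (by simpa using hkj)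
  have hj1 := T.hl j
  have hj2 := T.hm j
  have hj3 := T.hr j
  have hk1 := T.hl k
  have hk2 := T.hm k
  have hk3 := T.hr k
  have hA := T.lt (T.ch (false, k))
  have hB := T.lt (T.ch (true, k))
  have hC := T.lt (T.ch (true, j))
  have hlen := T.len_le j
  have hMp := T.M_pos
  let π : Equiv.Perm (Bool × Fin n) := Equiv.swap (false, j) (false, k) *
    Equiv.swap (false, k) (true, k) * Equiv.swap (true, k) (true, j)
  have hπ1 : π (false, j) = (false, k) := by simp [π, Equiv.swap_apply_def, hjk]
  have hπ2 : π (true, j) = (false, j) := by simp [π, Equiv.swap_apply_def, hjk]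
  have hπ3 : π (false, k) = (true, k) := by simp [π, Equiv.swap_apply_def, hkj]
  have hπ4 : π (true, k) = (true, j) := by simp [π, Equiv.swap_apply_def, hjk]
  have hπo : ∀ b m, m ≠ j → m ≠ k → π (b, m) = (b, m) := by
    intro b m h1 h2
    simp [π, Equiv.swap_apply_def, h1, h2]
  let st' : XX n → ℤ := Function.update T.st (Sum.inl k) (T.st (T.ch (true, k)))
  let en' : XX n → ℤ := Function.update T.en (Sum.inl k) (T.en (T.ch (true, j)))
  have hs1 : st' (Sum.inl k) = T.st (T.ch (true, k)) := Function.update_self _ _ _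
  have hs2 : en' (Sum.inl k) = T.en (T.ch (true, j)) := Function.update_self _ _ _
  have hs3 : ∀ x, x ≠ Sum.inl k → st' x = T.st x := fun x hx => Function.update_of_ne hx _ _
  have hs4 : ∀ x, x ≠ Sum.inl k → en' x = T.en x := fun x hx => Function.update_of_ne hx _ _
  have hoth : ∀ b m, m ≠ j → T.ch (b, m) ≠ Sum.inl k := by
    intro b m hm; rw [← h]; exact T.ch_ne_ch (by simp [hm])
  have hnod : ∀ m, m ≠ k → (Sum.inl m : XX n) ≠ Sum.inl k := by intro m hm; simpa using hm
  let T' : Tri n :=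
    { ρ := T.ρ
      ch := T.ch ∘ π
      st := st'
      en := en'
      M := T.M
      inj := T.inj.comp π.injective
      ne_root := fun s => T.ne_root _
      cov := fun i hi => by
        obtain ⟨s, hs⟩ := T.cov i hi
        exact ⟨π.symm s, by simpa using hs⟩
      hl := fun m => by
        by_cases hm : m = j
        · subst hm
          simp only [Function.comp, hπ1]
          rw [hs3 _ n2.symm, hs3 _ n1.symm, hk1, ← h, hj1]
        · by_cases hm' : m = k
          · subst hm'
            simp only [Function.comp, hπ3]
            rw [hs3 _ n3.symm, hs1]
          · simp only [Function.comp, hπo _ _ hm hm']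
            rw [hs3 _ (hoth _ _ hm), hs3 _ (hnod _ hm'), T.hl]
      hm := fun m => by
        by_cases hm : m = j
        · subst hm
          simp only [Function.comp, hπ1, hπ2]
          rw [h, hs1, hs4 _ n2.symm, hk2]
        · by_cases hm' : m = k
          · subst hm'
            simp only [Function.comp, hπ3, hπ4]
            rw [hs4 _ n3.symm, hs3 _ n4.symm, hk3, ← hj2, h]
          · simp only [Function.comp, hπo _ _ hm hm']
            rw [hs3 _ (hoth _ _ hm), hs4 _ (hoth _ _ hm), T.hm]
      hr := fun m => by
        by_cases hm : m = j
        · subst hm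
          simp only [Function.comp, hπ2]
          rw [h, hs2, hs4 _ n1.symm, hj3]
        · by_cases hm' : m = k
          · subst hm'
            simp only [Function.comp, hπ4]
            rw [hs2, hs4 _ n4.symm]
          · simp only [Function.comp, hπo _ _ hm hm']
            rw [hs4 _ (hoth _ _ hm), hs4 _ (hnod _ hm'), T.hr]
      lt := fun x => by
        by_cases hx : x = Sum.inl k
        · rw [hx, hs1, hs2, ]
          rw [h] at hj2
          omega
        · rw [hs3 _ hx, hs4 _ hx]; exact T.lt x
      per := by
        rw [hs3 _ (hnod _ hkρ.symm), hs4 _ (hnod _ hkρ.symm)]; exact T.per }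
  have ht : ∀ x y, T'.t x y = T.t x y +
      (tau (Sum.inl j) (T.ch (false, k)) (Sum.inl k) x y +
        tau (Sum.inl k) (T.ch (true, k)) (T.ch (true, j)) x y -
      (tau (Sum.inl j) (Sum.inl k) (T.ch (true, j)) x y +
        tau (Sum.inl k) (T.ch (false, k)) (T.ch (true, k)) x y)) := by
    intro x y
    have : T'.t x y - T.t x y =
      (tau (Sum.inl j) (T.ch (false, k)) (Sum.inl k) x y +
        tau (Sum.inl k) (T.ch (true, k)) (T.ch (true, j)) x y -
      (tau (Sum.inl j) (Sum.inl k) (T.ch (true, j)) x y +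
        tau (Sum.inl k) (T.ch (false, k)) (T.ch (true, k)) x y)) := by
      unfold t
      rw [← Finset.sum_sub_distrib]
      rw [Fintype.sum_eq_add j k hjk]
      · simp only [T', Function.comp, hπ1, hπ2, hπ3, hπ4, h]
        ring
      · intro m hm
        simp only [T', Function.comp, hπo _ _ hm.1 hm.2]; ring
    linarith
  have hcol := T.t_col_left h
  have hdd : T.dd k = 1 := if_neg hkρ
  have hb : ∀ x, T.b x k = dl x (T.ch (true, k)) - dl x (T.ch (false, k)) + dl x (Sum.inl j)
      - dl x (T.ch (true, j)) := by
    intro x; unfold b; rw [hcol, hdd, mul_one]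
  have hk2' : T.st (T.ch (true, j)) = T.en (Sum.inl k) := by rw [← hj2, h]
  have hk1' : T.st (Sum.inl k) = T.st (Sum.inl j) := by rw [← h, hj1]
  refine ⟨T', T.st (Sum.inl j), T.st (T.ch (true, k)), T.st (T.ch (true, j)), T.en (Sum.inl j),
    rfl, by omega, by omega, by omega, by omega, b_mut (T := T) (T' := T') rfl k ?_ ?_, ?_, ?_,
    Or.inr ?_⟩
  · intro x
    rw [ht, hcol, tau_flip_col n1 n2 n3 n4, tau_col_left n1 n2 n3 n4]
    ring
  · intro x y hx hy
    rw [ht, hcol, T.t_anti (Sum.inl k) y, hcol, tau_flip n5 n6 n7 n8 n9 n10 hx hy, hdd, mul_one]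
  · intro f hf x hx
    change f (st' x) (en' x) = _
    rw [hs3 _ hx, hs4 _ hx]
  · intro f hf
    change f (st' _) (en' _) + _ = _
    rw [hs1, hs2, hj3, hk2', hk1']; ring
  · intro f hf
    have := sum_pos_part n5 n6 n7 n8 n9 n10 (fun x => f (T.st x) (T.en x))
    simp only [hb]
    rw [this.1, this.2]
    rw [hk3, hk2, hj3, hk1, hk2', hk1']
    exact ⟨rfl, rfl⟩

lemma exists_flip_right {j k : Fin n} (h : T.ch (true, j) = Sum.inl k) :
    ∃ T' : Tri n, ∃ a b c d, FlipData T T' k a b c d := by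
  classical
  have hjk : j ≠ k := by rintro rfl; exact T.ne_self _ h
  have hkj : k ≠ j := hjk.symm
  have hkρ : k ≠ T.ρ := by rintro rfl; exact T.ne_root _ h
  have n1 : (Sum.inl k : XX n) ≠ Sum.inl j := by simpa using hkj
  have n2 : (Sum.inl k : XX n) ≠ T.ch (false, j) := by rw [← h]; exact T.ch_ne_ch (by simp)
  have n3 := (T.ne_self (false, k)).symm
  have n4 := (T.ne_self (true, k)).symm
  have n5 := (T.ne_self (false, j)).symm
  have n6 := (T.ch_ne_par h false).symm
  have n7 := (T.ch_ne_par h true).symm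
  have n8 : T.ch (false, j) ≠ T.ch (false, k) := T.ch_ne_ch (by simpa using hjk)
  have n9 : T.ch (false, j) ≠ T.ch (true, k) := T.ch_ne_ch (by simp)
  have n10 : T.ch (false, k) ≠ T.ch (true, k) := T.ch_ne_ch (by simp)
  have hj1 := T.hl j
  have hj2 := T.hm j
  have hj3 := T.hr j
  have hk1 := T.hl k
  have hk2 := T.hm k
  have hk3 := T.hr k
  have hA := T.lt (T.ch (false, j))
  have hB := T.lt (T.ch (false, k))
  have hC := T.lt (T.ch (true, k))
  have hlen := T.len_le j
  have hMp := T.M_pos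
  let π : Equiv.Perm (Bool × Fin n) := Equiv.swap (true, j) (true, k) *
    Equiv.swap (true, k) (false, k) * Equiv.swap (false, k) (false, j)
  have hπ1 : π (true, j) = (true, k) := by simp [π, Equiv.swap_apply_def, hjk]
  have hπ2 : π (false, j) = (true, j) := by simp [π, Equiv.swap_apply_def, hjk]
  have hπ3 : π (true, k) = (false, k) := by simp [π, Equiv.swap_apply_def, hkj]
  have hπ4 : π (false, k) = (false, j) := by simp [π, Equiv.swap_apply_def, hjk]
  have hπo : ∀ b m, m ≠ j → m ≠ k → π (b, m) = (b, m) := by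
    intro b m h1 h2
    simp [π, Equiv.swap_apply_def, h1, h2]
  let st' : XX n → ℤ := Function.update T.st (Sum.inl k) (T.st (T.ch (false, j)))
  let en' : XX n → ℤ := Function.update T.en (Sum.inl k) (T.en (T.ch (false, k)))
  have hs1 : st' (Sum.inl k) = T.st (T.ch (false, j)) := Function.update_self _ _ _
  have hs2 : en' (Sum.inl k) = T.en (T.ch (false, k)) := Function.update_self _ _ _
  have hs3 : ∀ x, x ≠ Sum.inl k → st' x = T.st x := fun x hx => Function.update_of_ne hx _ _
  have hs4 : ∀ x, x ≠ Sum.inl k → en' x = T.en x := fun x hx => Function.update_of_ne hx _ _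
  have hoth : ∀ b m, m ≠ j → T.ch (b, m) ≠ Sum.inl k := by
    intro b m hm; rw [← h]; exact T.ch_ne_ch (by simp [hm])
  have hnod : ∀ m, m ≠ k → (Sum.inl m : XX n) ≠ Sum.inl k := by intro m hm; simpa using hm
  have hk2' : T.en (T.ch (false, j)) = T.st (Sum.inl k) := by rw [hj2, h]
  have hk1' : T.en (Sum.inl k) = T.en (Sum.inl j) := by rw [← h, hj3]
  let T' : Tri n :=
    { ρ := T.ρ
      ch := T.ch ∘ π
      st := st'
      en := en'
      M := T.M
      inj := T.inj.comp π.injective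
      ne_root := fun s => T.ne_root _
      cov := fun i hi => by
        obtain ⟨s, hs⟩ := T.cov i hi
        exact ⟨π.symm s, by simpa using hs⟩
      hl := fun m => by
        by_cases hm : m = j
        · subst hm
          simp only [Function.comp, hπ2]
          rw [h, hs1, hs3 _ n1.symm, hj1]
        · by_cases hm' : m = k
          · subst hm'
            simp only [Function.comp, hπ4]
            rw [hs3 _ n2.symm, hs1]
          · simp only [Function.comp, hπo _ _ hm hm']
            rw [hs3 _ (hoth _ _ hm), hs3 _ (hnod _ hm'), T.hl]
      hm := fun m => by
        by_cases hm : m = j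
        · subst hm
          simp only [Function.comp, hπ1, hπ2]
          rw [h, hs2, hs3 _ n4.symm, hk2]
        · by_cases hm' : m = k
          · subst hm'
            simp only [Function.comp, hπ3, hπ4]
            rw [hs4 _ n2.symm, hs3 _ n3.symm, hk2', hk1]
          · simp only [Function.comp, hπo _ _ hm hm']
            rw [hs3 _ (hoth _ _ hm), hs4 _ (hoth _ _ hm), T.hm]
      hr := fun m => by
        by_cases hm : m = j
        · subst hm
          simp only [Function.comp, hπ1]
          rw [hs4 _ n4.symm, hs4 _ n1.symm, hk3, hk1']
        · by_cases hm' : m = k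
          · subst hm'
            simp only [Function.comp, hπ3]
            rw [hs2, hs4 _ n3.symm]
          · simp only [Function.comp, hπo _ _ hm hm']
            rw [hs4 _ (hoth _ _ hm), hs4 _ (hnod _ hm'), T.hr]
      lt := fun x => by
        by_cases hx : x = Sum.inl k
        · rw [hx, hs1, hs2]
          omega
        · rw [hs3 _ hx, hs4 _ hx]; exact T.lt x
      per := by
        rw [hs3 _ (hnod _ hkρ.symm), hs4 _ (hnod _ hkρ.symm)]; exact T.per }
  have ht : ∀ x y, T'.t x y = T.t x y +
      (tau (Sum.inl j) (Sum.inl k) (T.ch (true, k)) x y +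
        tau (Sum.inl k) (T.ch (false, j)) (T.ch (false, k)) x y -
      (tau (Sum.inl j) (T.ch (false, j)) (Sum.inl k) x y +
        tau (Sum.inl k) (T.ch (false, k)) (T.ch (true, k)) x y)) := by
    intro x y
    have : T'.t x y - T.t x y =
      (tau (Sum.inl j) (Sum.inl k) (T.ch (true, k)) x y +
        tau (Sum.inl k) (T.ch (false, j)) (T.ch (false, k)) x y -
      (tau (Sum.inl j) (T.ch (false, j)) (Sum.inl k) x y +
        tau (Sum.inl k) (T.ch (false, k)) (T.ch (true, k)) x y)) := by
      unfold t
      rw [← Finset.sum_sub_distrib]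
      rw [Fintype.sum_eq_add j k hjk]
      · simp only [T', Function.comp, hπ1, hπ2, hπ3, hπ4, h]
        ring
      · intro m hm
        simp only [T', Function.comp, hπo _ _ hm.1 hm.2]; ring
    linarith
  have hcol := T.t_col_right h
  have hdd : T.dd k = 1 := if_neg hkρ
  have hb : ∀ x, T.b x k = -(dl x (T.ch (false, k)) - dl x (T.ch (false, j)) + dl x (Sum.inl j)
      - dl x (T.ch (true, k))) := by
    intro x; unfold b; rw [hcol, hdd, mul_one]
  refine ⟨T', T.st (Sum.inl j), T.st (Sum.inl k), T.st (T.ch (true, k)), T.en (Sum.inl j),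
    rfl, by omega, by omega, by omega, by omega, b_mut (T := T) (T' := T') rfl k ?_ ?_, ?_, ?_,
    Or.inl ?_⟩
  · intro x
    rw [ht, hcol, tau_flip_col n1 n2 n3 n4, tau_col_left n1 n2 n3 n4]
    ring
  · intro x y hx hy
    rw [ht, hcol, T.t_anti (Sum.inl k) y, hcol, tau_flip_inv n5 n6 n7 n8 n9 n10 hx hy, hdd, mul_one, neg_neg]
  · intro f hf x hx
    change f (st' x) (en' x) = _
    rw [hs3 _ hx, hs4 _ hx]
  · intro f hf
    change f (st' _) (en' _) + _ = _
    rw [hs1, hs2, hj1, hk2, hk1']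
  · intro f hf
    have := sum_pos_part n5 n6 n7 n8 n9 n10 (fun x => f (T.st x) (T.en x))
    simp only [hb, neg_neg]
    rw [this.1, this.2]
    rw [hk3, hk2, hk1, hj1, hk1', hk2']
    exact ⟨rfl, rfl⟩

lemma exists_flip (k : Fin n) : ∃ T' : Tri n, ∃ a b c d, FlipData T T' k a b c d := by
  by_cases hk : k = T.ρ
  · subst hk; exact T.exists_flip_root
  · obtain ⟨⟨b, j⟩, h⟩ := T.cov k hk
    cases b
    · exact T.exists_flip_left h
    · exact T.exists_flip_right h

end Tri

/-- Tropical mutation of shear coordinates. -/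
lemma tropical {n : ℕ} (k : Fin n) (b b' : XX n → Fin n → ℤ) (w w' : XX n → ℤ)
    (h0 : b (Sum.inl k) k = 0)
    (hb : ∀ x j, b' x j = if x = Sum.inl k ∨ j = k then -b x j
      else b x j + (b x k).sign * max (b x k * b (Sum.inl k) j) 0)
    (hw : ∀ x, x ≠ Sum.inl k → w' x = w x)
    (hk : w' (Sum.inl k) + w (Sum.inl k) =
      max (∑ x, max (b x k) 0 * w x) (∑ x, max (-b x k) 0 * w x)) (j : Fin n) :
    -∑ x, b' x j * w' x = if j = k then -(-∑ x, b x k * w x) else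
      (-∑ x, b x j * w x) + (-∑ x, b x k * w x).sign *
        max ((-∑ x, b x k * w x) * b (Sum.inl k) j) 0 := by
  split_ifs with hj
  · subst hj
    rw [← Finset.sum_neg_distrib, neg_neg]
    apply Finset.sum_congr rfl
    intro x _
    rw [hb, if_pos (Or.inr rfl)]
    by_cases hx : x = Sum.inl j
    · rw [hx, h0]; ring
    · rw [hw x hx]; ring
  · set P := ∑ x, max (b x k) 0 * w x with hP
    set N := ∑ x, max (-b x k) 0 * w x with hN
    have e1 : -∑ x, b x k * w x = N - P := by
      rw [hN, hP, ← Finset.sum_sub_distrib, ← Finset.sum_neg_distrib]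
      apply Finset.sum_congr rfl
      intro x _
      rw [← sub_mul, ← neg_mul]
      congr 1
      rcases max_zero_cases (b x k) with ⟨h1, h2⟩ | ⟨h1, h2⟩
      · rw [h2, max_eq_right (by omega)]; ring
      · rw [h2, max_eq_left (by omega)]; ring
    have e2 : ∀ x, b' x j * w' x = b x j * w x + (max (b x k) 0 * w x * max (b (Sum.inl k) j) 0 -
        max (-b x k) 0 * w x * max (-b (Sum.inl k) j) 0) -
        dl x (Sum.inl k) * (b (Sum.inl k) j * (w' (Sum.inl k) + w (Sum.inl k))) := by
      intro x
      rw [hb]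
      by_cases hx : x = Sum.inl k
      · rw [if_pos (Or.inl hx), hx, h0]; simp [dl]; ring
      · rw [if_neg (by push Not; exact ⟨hx, hj⟩), hw x hx, sign_mul_max]; simp [dl, hx]; ring
    have e3 : ∑ x, b' x j * w' x = ∑ x, b x j * w x + (P * max (b (Sum.inl k) j) 0 -
        N * max (-b (Sum.inl k) j) 0) - b (Sum.inl k) j * max P N := by
      simp only [e2, Finset.sum_add_distrib, Finset.sum_sub_distrib]
      rw [sum_dl_mul (Sum.inl k) (fun _ => b (Sum.inl k) j * (w' (Sum.inl k) + w (Sum.inl k))), hk,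
        ← Finset.sum_mul, ← Finset.sum_mul]
    rw [e1, e3, sign_mul_max]
    rcases le_total P N with h | h
    · rw [max_eq_right h, max_eq_left (by omega : 0 ≤ N - P), max_eq_right (by omega : -(N - P) ≤ 0)]
      rcases max_zero_cases (b (Sum.inl k) j) with ⟨h1, h2⟩ | ⟨h1, h2⟩
      · rw [h2, max_eq_right (by omega : -b (Sum.inl k) j ≤ 0)]; ring
      · rw [h2, max_eq_left (by omega : 0 ≤ -b (Sum.inl k) j)]; ring
    · rw [max_eq_left h, max_eq_right (by omega : N - P ≤ 0), max_eq_left (by omega : 0 ≤ -(N - P))]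
      rcases max_zero_cases (b (Sum.inl k) j) with ⟨h1, h2⟩ | ⟨h1, h2⟩
      · rw [h2, max_eq_right (by omega : -b (Sum.inl k) j ≤ 0)]; ring
      · rw [h2, max_eq_left (by omega : 0 ≤ -b (Sum.inl k) j)]; ring

/-- The Ptolemy relation. -/
def Ptol (M : ℤ) (f : ℤ → ℤ → ℤ) : Prop := ∀ a b c d, a < b → b < c → c < d → d < a + 2 * M →
  f a c + f b d = max (f a b + f c d) (f b c + f a d)

/-- Compatibility of two functions on arcs. -/
def Compat (M : ℤ) (f g : ℤ → ℤ → ℤ) : Prop := ∀ a b c d, a < b → b < c → c < d → d < a + 2 * M →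
  0 ≤ (f a b + f c d - (f b c + f a d)) * (g a b + g c d - (g b c + g a d))

lemma Tri.mat_of_flip {n : ℕ} {T T' : Tri n} {k : Fin n} {a b c d : ℤ}
    (h : FlipData T T' k a b c d) : T'.mat = mutMat k T.mat := by
  ext i j
  simp only [Tri.mat, mutMat, h.hb, Sum.inl.injEq]

lemma common_sign {n : ℕ} (s : Fin n → ℤ) (h : ∀ i i', 0 ≤ s i * s i') :
    ∃ e : ℤ, (e = 1 ∨ e = -1) ∧ ∀ i, 0 ≤ e * s i := by
  by_cases h0 : ∃ i, s i < 0
  · obtain ⟨i, hi⟩ := h0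
    refine ⟨-1, Or.inr rfl, fun i' => ?_⟩
    have := h i i'
    nlinarith
  · push Not at h0
    exact ⟨1, Or.inl rfl, fun i => by rw [one_mul]; exact h0 i⟩

lemma sc_of {n : ℕ} (T0 : Tri n) (f : Fin n → ℤ → ℤ → ℤ) (z : Fin n → ℤ) (hz : ∀ i, 0 < z i)
    (hI : ∀ i, FInv T0.M (f i)) (hP : ∀ i, Ptol T0.M (f i)) (hC : ∀ i i', Compat T0.M (f i) (f i'))
    (h0 : ∀ i j, ∑ x, T0.b x j * f i (T0.st x) (T0.en x) = if i = j then -z i else 0) :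
    SC T0.mat := by
  have key : ∀ ls, ∃ T : Tri n, T.M = T0.M ∧ T.mat = Bp T0.mat ls ∧
      ∀ i j, z i * Cp T0.mat 1 ls i j = -∑ x, T.b x j * f i (T.st x) (T.en x) := by
    intro ls
    induction ls using List.reverseRecOn with
    | nil =>
      refine ⟨T0, rfl, rfl, fun i j => ?_⟩
      rw [h0]
      simp [Cp, Matrix.one_apply]
      split_ifs <;> simp
    | append_singleton ls k ih =>
      obtain ⟨T, hM, hB, hT⟩ := ih
      obtain ⟨T', a, b, c, d, hF⟩ := T.exists_flip k
      refine ⟨T', hF.hM.trans hM, ?_, fun i j => ?_⟩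
      · rw [Tri.mat_of_flip hF, hB, Bp_append]
      · have hIi : FInv T.M (f i) := hM ▸ hI i
        rw [Cp_append, tropical k T.b T'.b (fun x => f i (T.st x) (T.en x))
          (fun x => f i (T'.st x) (T'.en x)) (by simp [Tri.b, Tri.t_diag]) hF.hb (hF.hw _ hIi) ?_ j]
        · rw [← hT i k, ← hT i j]
          have hbb : T.b (Sum.inl k) j = Bp T0.mat ls k j := by rw [← hB]; rfl
          rw [hbb]
          simp only [mutC]
          split_ifs with hj
          · rw [hj]; ring
          · rw [Int.sign_mul, Int.sign_eq_one_of_pos (hz i), mul_assoc (z i), max_mul_of_pos _ _ (hz i)]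
            ring
        · rw [hF.hk _ hIi, hP i a b c d hF.hab hF.hbc hF.hcd (by have := hF.hda; rw [hM] at this; exact this)]
          rcases hF.hs with h | h
          · rw [(h _ hIi).1, (h _ hIi).2]
          · rw [(h _ hIi).1, (h _ hIi).2, max_comm]
  intro ls j
  obtain ⟨T, hM, hB, hT⟩ := key ls
  obtain ⟨T', a, b, c, d, hF⟩ := T.exists_flip j
  have hda : d < a + 2 * T0.M := by have := hF.hda; rw [hM] at this; exact this
  have hsum : ∀ i, ∑ x, T.b x j * f i (T.st x) (T.en x) =
      ∑ x, max (T.b x j) 0 * f i (T.st x) (T.en x) - ∑ x, max (-T.b x j) 0 * f i (T.st x) (T.en x) := by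
    intro i
    rw [← Finset.sum_sub_distrib]
    apply Finset.sum_congr rfl
    intro x _
    rw [← sub_mul]
    congr 1
    rcases max_zero_cases (T.b x j) with ⟨h1, h2⟩ | ⟨h1, h2⟩
    · rw [h2, max_eq_right (by omega)]; ring
    · rw [h2, max_eq_left (by omega)]; ring
  have hprod : ∀ i i', 0 ≤ (z i * Cp T0.mat 1 ls i j) * (z i' * Cp T0.mat 1 ls i' j) := by
    intro i i'
    have hIi : ∀ i, FInv T.M (f i) := fun i => hM ▸ hI i
    have hc := hC i i' a b c d hF.hab hF.hbc hF.hcd hda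
    rw [hT, hT, hsum, hsum]
    rcases hF.hs with h | h
    · rw [(h _ (hIi i)).1, (h _ (hIi i)).2, (h _ (hIi i')).1, (h _ (hIi i')).2]
      rw [neg_mul_neg]; exact hc
    · rw [(h _ (hIi i)).1, (h _ (hIi i)).2, (h _ (hIi i')).1, (h _ (hIi i')).2]
      rw [neg_sub, neg_sub]; exact hc
  obtain ⟨e, he, he'⟩ := common_sign _ hprod
  refine ⟨e, he, fun i => ?_⟩
  have h1 := he' i
  have h2 : 0 ≤ z i * (e * Cp T0.mat 1 ls i j) := by
    calc 0 ≤ _ := h1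
      _ = _ := by ring
  exact nonneg_of_mul_nonneg_right h2 (hz i)

namespace Tri

variable {n : ℕ} (T : Tri n)

/-- The interval of `x` is contained in that of `y`. -/
def ins (x y : XX n) : Prop := T.st y ≤ T.st x ∧ T.en x ≤ T.en y

/-- Relative position of two nodes. -/
def Rel (m i : Fin n) : Prop := i = m ∨ (∃ b, T.ins (Sum.inl i) (T.ch (b, m))) ∨
  (∃ b, T.ins (Sum.inl m) (T.ch (b, i))) ∨ T.en (Sum.inl i) ≤ T.st (Sum.inl m) ∨
  T.en (Sum.inl m) ≤ T.st (Sum.inl i)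

lemma Rel.symm {T : Tri n} {m i : Fin n} (h : T.Rel m i) : T.Rel i m := by
  rcases h with h | h | h | h | h
  · exact Or.inl h.symm
  · exact Or.inr (Or.inr (Or.inl h))
  · exact Or.inr (Or.inl h)
  · exact Or.inr (Or.inr (Or.inr (Or.inr h)))
  · exact Or.inr (Or.inr (Or.inr (Or.inl h)))

lemma rel_root (i : Fin n) : T.Rel T.ρ i := by
  have h1 := T.in_root i
  have h2 := T.hl T.ρ
  have h3 := T.hm T.ρ
  have h4 := T.hr T.ρ
  rcases T.mid_root i with h | h | h
  · exact Or.inl h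
  · exact Or.inr (Or.inl ⟨false, by unfold ins; omega⟩)
  · exact Or.inr (Or.inl ⟨true, by unfold ins; omega⟩)

lemma siblings (b b' : Bool) (m : Fin n) (h : b ≠ b') :
    T.en (T.ch (b, m)) ≤ T.st (T.ch (b', m)) ∨ T.en (T.ch (b', m)) ≤ T.st (T.ch (b, m)) := by
  have h3 := T.hm m
  cases b <;> cases b' <;> simp at h ⊢ <;> omega

lemma rel_all (m : Fin n) : ∀ i, T.Rel m i := by
  refine T.node_ind (P := fun m => ∀ i, T.Rel m i) T.rel_root ?_ m
  rintro ⟨b, j⟩ m hj hm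
  simp only [] at hj
  have cm := T.ch_st_le (b, j)
  have lm := T.lt (Sum.inl m)
  rw [hm] at cm
  simp only [] at cm
  refine T.node_ind (P := fun i => T.Rel m i) (T.rel_root m).symm ?_
  rintro ⟨b0, i0⟩ i h0 hi
  simp only [] at h0
  have ci := T.ch_st_le (b0, i0)
  have li := T.lt (Sum.inl i)
  rw [hi] at ci
  simp only [] at ci
  rcases hj i with h | ⟨b1, h⟩ | ⟨b1, h⟩ | h | h
  · subst h
    exact Or.inr (Or.inr (Or.inl ⟨b, by rw [hm]; exact ⟨le_rfl, le_rfl⟩⟩))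
  · by_cases hb : b = b1
    · subst hb
      rw [hm] at h
      unfold ins at h
      rcases h0 with h0 | ⟨b2, h0⟩ | ⟨b2, h0⟩ | h0 | h0
      · subst h0
        exact Or.inr (Or.inl ⟨b0, by rw [hi]; exact ⟨le_rfl, le_rfl⟩⟩)
      · unfold ins at h0
        exact Or.inr (Or.inl ⟨b2, by unfold ins; omega⟩)
      · unfold ins at h0
        by_cases hb2 : b2 = b0
        · subst hb2
          rw [hi] at h0
          rcases hj i0 with h3 | ⟨b3, h3⟩ | ⟨b3, h3⟩ | h3 | h3
          · subst h3
            by_cases hb3 : b = b2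
            · subst hb3
              rw [hi] at hm
              exact Or.inl (by simpa using hm)
            · have := T.siblings _ _ i0 hb3
              rw [hm, hi] at this
              omega
          · unfold ins at h3
            by_cases hb3 : b = b3
            · subst hb3
              rw [hm] at h3
              omega
            · have := T.siblings _ _ j hb3
              rw [hm] at this
              omega
          · unfold ins at h3
            by_cases hb3 : b2 = b3
            · subst hb3
              rw [hi] at h3
              omega
            · have := T.siblings _ _ i0 hb3
              rw [hi] at this
              omega
          · omega
          · omega
        · have := T.siblings _ _ i0 hb2
          rw [hi] at this
          right; right; right; omega
      · right; right; right; omega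
      · right; right; right; omega
    · have := T.siblings _ _ j hb
      rw [hm] at this
      unfold ins at h
      right; right; right; omega
  · unfold ins at h
    exact Or.inr (Or.inr (Or.inl ⟨b1, by unfold ins; omega⟩))
  · right; right; right; omega
  · right; right; right; omega

/-- Intervals of nodes form a laminar family. -/
lemma laminar (i j : Fin n) : T.ins (Sum.inl i) (Sum.inl j) ∨ T.ins (Sum.inl j) (Sum.inl i) ∨
    T.en (Sum.inl i) ≤ T.st (Sum.inl j) ∨ T.en (Sum.inl j) ≤ T.st (Sum.inl i) := by
  rcases T.rel_all i j with h | ⟨b, h⟩ | ⟨b, h⟩ | h | h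
  · subst h; exact Or.inl ⟨le_rfl, le_rfl⟩
  · have := T.ch_st_le (b, i)
    unfold ins at *; simp only [] at this; omega
  · have := T.ch_st_le (b, j)
    unfold ins at *; simp only [] at this; omega
  · omega
  · omega

end Tri

/-! ### Splits of the circle -/

/-- Distance on booleans. -/
def dB (x y : Bool) : ℤ := if x = y then 0 else 1

/-- Normalized position of a point on a circle of circumference `2 * M`. -/
def nv (P M v : ℤ) : ℤ := (v - P - 1) % (2 * M)

/-- The split given by an interval. -/
def spl (P M lo hi v : ℤ) : Bool := decide (lo ≤ nv P M v ∧ nv P M v < hi)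

lemma nv_eq {P M v : ℤ} (q r : ℤ) (h : v - P - 1 = r + 2 * M * q) (h0 : 0 ≤ r) (h1 : r < 2 * M) :
    nv P M v = r := by
  unfold nv
  rw [h, Int.add_mul_emod_self_left]
  exact Int.emod_eq_of_lt h0 h1

lemma nv_bd {P M : ℤ} (hM : 0 < M) (v : ℤ) : 0 ≤ nv P M v ∧ nv P M v < 2 * M :=
  ⟨Int.emod_nonneg _ (by omega), Int.emod_lt_of_pos _ (by omega)⟩

lemma nv_ex {P M : ℤ} (v : ℤ) : ∃ q, v - P - 1 = nv P M v + 2 * M * q :=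
  ⟨(v - P - 1) / (2 * M), (Int.emod_add_mul_ediv _ _).symm⟩

lemma nv_per {P M : ℤ} (v : ℤ) : nv P M (v + 2 * M) = nv P M v := by
  unfold nv
  rw [show v + 2 * M - P - 1 = v - P - 1 + 2 * M * 1 by ring, Int.add_mul_emod_self_left]

lemma nv_shift {P M : ℤ} (hM : 0 < M) (v : ℤ) :
    (nv P M v < M ∧ nv P M (v + M) = nv P M v + M) ∨
    (M ≤ nv P M v ∧ nv P M (v + M) = nv P M v - M) := by
  have hb := nv_bd (P := P) hM v
  obtain ⟨q, hq⟩ := nv_ex (P := P) (M := M) v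
  rcases lt_or_ge (nv P M v) M with h | h
  · exact Or.inl ⟨h, nv_eq q _ (by linarith) (by omega) (by omega)⟩
  · exact Or.inr ⟨h, nv_eq (q + 1) _ (by linarith) (by omega) (by omega)⟩

lemma nv_local {P M : ℤ} (hM : 0 < M) (a v : ℤ) (h1 : a ≤ v) (h2 : v < a + 2 * M) :
    (nv P M a + (v - a) < 2 * M ∧ nv P M v = nv P M a + (v - a)) ∨
    (2 * M ≤ nv P M a + (v - a) ∧ nv P M v = nv P M a + (v - a) - 2 * M) := by
  have hb := nv_bd (P := P) hM a
  obtain ⟨q, hq⟩ := nv_ex (P := P) (M := M) a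
  rcases lt_or_ge (nv P M a + (v - a)) (2 * M) with h | h
  · exact Or.inl ⟨h, nv_eq q _ (by linarith) (by omega) (by omega)⟩
  · exact Or.inr ⟨h, nv_eq (q + 1) _ (by linarith) (by omega) (by omega)⟩

lemma bool_ptol (x y z w : Bool) (h : ¬ (x = z ∧ y = w ∧ x ≠ y)) :
    dB x z + dB y w = max (dB x y + dB z w) (dB y z + dB x w) := by
  revert x y z w; unfold dB; decide

lemma bool_compat (x y z w x' y' z' w' α β : Bool) (h1 : ¬ (x = α ∧ x' = β))
    (h2 : ¬ (y = α ∧ y' = β)) (h3 : ¬ (z = α ∧ z' = β)) (h4 : ¬ (w = α ∧ w' = β)) :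
    0 ≤ (dB x y + dB z w - (dB y z + dB x w)) * (dB x' y' + dB z' w' - (dB y' z' + dB x' w')) := by
  revert x y z w x' y' z' w' α β; unfold dB; decide

lemma bool_zero (x y z w : Bool) (h1 : ¬ (x = w ∧ y = z ∧ x ≠ y)) (h2 : ¬ (x = y ∧ z = w ∧ x ≠ z)) :
    dB x y + dB z w = dB y z + dB x w := by
  revert x y z w; unfold dB; decide

lemma spl_true {P M lo hi v : ℤ} : spl P M lo hi v = true ↔ lo ≤ nv P M v ∧ nv P M v < hi := by
  simp [spl]

lemma spl_ptol {P M lo hi : ℤ} (hM : 0 < M) (h0 : 0 ≤ lo) (h1 : hi ≤ 2 * M) :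
    Ptol M (fun u v => dB (spl P M lo hi u) (spl P M lo hi v)) := by
  intro a b c d hab hbc hcd hda
  apply bool_ptol
  rintro ⟨e1, e2, e3⟩
  have ba := nv_bd (P := P) hM a
  have lb := nv_local (P := P) hM a b (by omega) (by omega)
  have lc := nv_local (P := P) hM a c (by omega) (by omega)
  have ld := nv_local (P := P) hM a d (by omega) (by omega)
  rw [Bool.eq_iff_iff, spl_true, spl_true] at e1 e2
  rw [Ne, Bool.eq_iff_iff, spl_true, spl_true] at e3
  omega

/-- Two intervals are nested or disjoint. -/
def Lam (lo hi lo' hi' : ℤ) : Prop := (lo ≤ lo' ∧ hi' ≤ hi) ∨ (lo' ≤ lo ∧ hi ≤ hi') ∨ hi ≤ lo' ∨ hi' ≤ lo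

lemma spl_compat {P M lo hi lo' hi' : ℤ} (h : Lam lo hi lo' hi') :
    Compat M (fun u v => dB (spl P M lo hi u) (spl P M lo hi v))
      (fun u v => dB (spl P M lo' hi' u) (spl P M lo' hi' v)) := by
  have key : ∃ α β, ∀ v, ¬ (spl P M lo hi v = α ∧ spl P M lo' hi' v = β) := by
    rcases h with h | h | h
    · refine ⟨false, true, fun v => ?_⟩
      rw [← Bool.not_eq_true, spl_true, spl_true]; omega
    · refine ⟨true, false, fun v => ?_⟩
      rw [← Bool.not_eq_true, spl_true, spl_true]; omega
    · refine ⟨true, true, fun v => ?_⟩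
      rw [spl_true, spl_true]; omega
  obtain ⟨α, β, h⟩ := key
  intro a b c d _ _ _ _
  exact bool_compat _ _ _ _ _ _ _ _ α β (h a) (h b) (h c) (h d)

lemma Ptol.add {M : ℤ} {f g : ℤ → ℤ → ℤ} (hf : Ptol M f) (hg : Ptol M g) (h : Compat M f g) :
    Ptol M (fun u v => f u v + g u v) := by
  intro a b c d h1 h2 h3 h4
  have e1 := hf a b c d h1 h2 h3 h4
  have e2 := hg a b c d h1 h2 h3 h4
  have e3 := h a b c d h1 h2 h3 h4
  have e4 : f a c + g a c + (f b d + g b d) = (f a c + f b d) + (g a c + g b d) := by ring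
  simp only []
  rw [e4, e1, e2]
  rcases le_total (f a b + f c d) (f b c + f a d) with h5 | h5 <;>
    rcases le_total (g a b + g c d) (g b c + g a d) with h6 | h6
  · rw [max_eq_right h5, max_eq_right h6, max_eq_right (by omega)]; ring
  · rcases eq_or_lt_of_le h5 with h7 | h7
    · rw [max_eq_right h5, max_eq_left h6, max_eq_left (by omega)]; omega
    · have : g a b + g c d = g b c + g a d := by
        by_contra hne
        have : 0 < g a b + g c d - (g b c + g a d) := by omega
        nlinarith
      rw [max_eq_right h5, max_eq_left h6, max_eq_right (by omega)]; omega
  · rcases eq_or_lt_of_le h5 with h7 | h7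
    · rw [max_eq_left h5, max_eq_right h6, max_eq_right (by omega)]; omega
    · have : g a b + g c d = g b c + g a d := by
        by_contra hne
        have : 0 < g b c + g a d - (g a b + g c d) := by omega
        nlinarith
      rw [max_eq_left h5, max_eq_right h6, max_eq_left (by omega)]; omega
  · rw [max_eq_left h5, max_eq_left h6, max_eq_left (by omega)]; ring

lemma Compat.add {M : ℤ} {f f' g g' : ℤ → ℤ → ℤ} (h1 : Compat M f g) (h2 : Compat M f g')
    (h3 : Compat M f' g) (h4 : Compat M f' g') :
    Compat M (fun u v => f u v + f' u v) (fun u v => g u v + g' u v) := by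
  intro a b c d a1 a2 a3 a4
  have e1 := h1 a b c d a1 a2 a3 a4
  have e2 := h2 a b c d a1 a2 a3 a4
  have e3 := h3 a b c d a1 a2 a3 a4
  have e4 := h4 a b c d a1 a2 a3 a4
  simp only []
  nlinarith

lemma spl_shift {P M lo hi : ℤ} (hM : 0 < M) (h0 : 0 ≤ lo) (h1 : hi ≤ M) (v : ℤ) :
    spl P M lo hi (v + M) = spl P M (lo + M) (hi + M) v ∧
    spl P M (lo + M) (hi + M) (v + M) = spl P M lo hi v := by
  have hb := nv_bd (P := P) hM v
  have hs := nv_shift (P := P) hM v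
  constructor <;> rw [Bool.eq_iff_iff, spl_true, spl_true] <;> omega

lemma spl_per {P M lo hi : ℤ} (v : ℤ) : spl P M lo hi (v + 2 * M) = spl P M lo hi v := by
  unfold spl; rw [nv_per]

/-- The symmetrized arc function of an interval. -/
def arcF (P M lo hi u v : ℤ) : ℤ := dB (spl P M lo hi u) (spl P M lo hi v) +
  dB (spl P M (lo + M) (hi + M) u) (spl P M (lo + M) (hi + M) v)

lemma arcF_inv {P M lo hi : ℤ} (hM : 0 < M) (h0 : 0 ≤ lo) (h1 : hi ≤ M) :
    FInv M (arcF P M lo hi) where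
  symm u v := by unfold arcF dB; simp only [eq_comm]
  sh u v := by
    unfold arcF
    rw [(spl_shift hM h0 h1 u).1, (spl_shift hM h0 h1 v).1, (spl_shift hM h0 h1 u).2,
      (spl_shift hM h0 h1 v).2, add_comm]
  per u v := by unfold arcF; rw [spl_per, spl_per]

lemma arcF_ptol {P M lo hi : ℤ} (hM : 0 < M) (h0 : 0 ≤ lo) (h1 : hi ≤ M) :
    Ptol M (arcF P M lo hi) :=
  (spl_ptol hM h0 (by omega)).add (spl_ptol hM (by omega) (by omega))
    (spl_compat (by unfold Lam; omega))

lemma arcF_compat {P M lo hi lo' hi' : ℤ} (h0 : 0 ≤ lo) (h1 : hi ≤ M)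
    (h0' : 0 ≤ lo') (h1' : hi' ≤ M) (h : Lam lo hi lo' hi') :
    Compat M (arcF P M lo hi) (arcF P M lo' hi') :=
  Compat.add (spl_compat h) (spl_compat (by unfold Lam; omega)) (spl_compat (by unfold Lam; omega))
    (spl_compat (by unfold Lam at *; omega))

lemma spl_in {P M s e v : ℤ} (hs : P ≤ s) (hse : s < e) (he : e ≤ P + M) (h1 : P ≤ v)
    (h2 : v ≤ P + M) :
    (spl P M (s - P) (e - P) v = true ↔ s < v ∧ v ≤ e) ∧
    (spl P M (s - P + M) (e - P + M) v = true ↔ v = P ∧ e = P + M) := by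
  have hnv : (v = P ∧ nv P M v = 2 * M - 1) ∨ (P < v ∧ nv P M v = v - P - 1) := by
    rcases eq_or_lt_of_le h1 with h | h
    · exact Or.inl ⟨h.symm, nv_eq (-1) _ (by linarith) (by omega) (by omega)⟩
    · exact Or.inr ⟨h, nv_eq 0 _ (by ring) (by omega) (by omega)⟩
  rw [spl_true, spl_true]
  omega

lemma arcF_zero {P M s e a b c d : ℤ} (hs : P ≤ s) (hse : s < e) (he : e ≤ P + M) (h1 : P ≤ a)
    (hab : a < b) (hbc : b < c) (hcd : c < d) (h2 : d ≤ P + M)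
    (h : (s ≤ a ∧ d ≤ e) ∨ ((a ≤ s ∨ e ≤ a) ∧ (b ≤ s ∨ e ≤ b) ∧ (c ≤ s ∨ e ≤ c) ∧ (d ≤ s ∨ e ≤ d))) :
    arcF P M (s - P) (e - P) a b + arcF P M (s - P) (e - P) c d =
      arcF P M (s - P) (e - P) b c + arcF P M (s - P) (e - P) a d := by
  have ia := spl_in hs hse he (v := a) (by omega) (by omega)
  have ib := spl_in hs hse he (v := b) (by omega) (by omega)
  have ic := spl_in hs hse he (v := c) (by omega) (by omega)
  have id := spl_in hs hse he (v := d) (by omega) (by omega)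
  have e1 := bool_zero (spl P M (s - P) (e - P) a) (spl P M (s - P) (e - P) b)
    (spl P M (s - P) (e - P) c) (spl P M (s - P) (e - P) d)
    (by simp only [Ne, Bool.eq_iff_iff, ia.1, ib.1, ic.1, id.1]; omega)
    (by simp only [Ne, Bool.eq_iff_iff, ia.1, ib.1, ic.1, id.1]; omega)
  have e2 := bool_zero (spl P M (s - P + M) (e - P + M) a) (spl P M (s - P + M) (e - P + M) b)
    (spl P M (s - P + M) (e - P + M) c) (spl P M (s - P + M) (e - P + M) d)
    (by simp only [Ne, Bool.eq_iff_iff, ia.2, ib.2, ic.2, id.2]; omega)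
    (by simp only [Ne, Bool.eq_iff_iff, ia.2, ib.2, ic.2, id.2]; omega)
  unfold arcF
  linarith

lemma dB_val (x y : Bool) (X Y : Prop) [Decidable X] [Decidable Y] (hx : x = true ↔ X) (hy : y = true ↔ Y) :
    dB x y = if (X ↔ Y) then 0 else 1 := by
  unfold dB
  exact if_congr (by rw [← hx, ← hy, Bool.eq_iff_iff]) rfl rfl

lemma arcF_val {P M s e u v : ℤ} (hs : P ≤ s) (hse : s < e) (he : e ≤ P + M) (h1 : P ≤ u)
    (h2 : u ≤ P + M) (h3 : P ≤ v) (h4 : v ≤ P + M) :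
    arcF P M (s - P) (e - P) u v = (if (s < u ∧ u ≤ e ↔ s < v ∧ v ≤ e) then 0 else 1) +
      if (u = P ∧ e = P + M ↔ v = P ∧ e = P + M) then 0 else 1 := by
  have iu := spl_in hs hse he h1 h2
  have iv := spl_in hs hse he h3 h4
  unfold arcF
  rw [dB_val _ _ _ _ iu.1 iv.1, dB_val _ _ _ _ iu.2 iv.2]

lemma arcF_two_left {P M a b c d : ℤ} (h1 : P ≤ a) (hab : a < b) (hbc : b < c) (hcd : c < d)
    (h2 : d ≤ P + M) :
    arcF P M (a - P) (c - P) b c - arcF P M (a - P) (c - P) a b + arcF P M (a - P) (c - P) a d -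
      arcF P M (a - P) (c - P) c d = -2 := by
  rw [arcF_val h1 (by omega) (by omega) (by omega) (by omega) (by omega) (by omega),
    arcF_val h1 (by omega) (by omega) (by omega) (by omega) (by omega) (by omega),
    arcF_val h1 (by omega) (by omega) (by omega) (by omega) (by omega) (by omega),
    arcF_val h1 (by omega) (by omega) (by omega) (by omega) (by omega) (by omega)]
  have e : ¬ (c = P + M) := by omega
  simp only [e, and_false, if_true, add_zero]
  rw [if_pos (by omega), if_neg (by omega), if_pos (by omega), if_neg (by omega)]
  norm_num

lemma arcF_two_right {P M a b c d : ℤ} (h1 : P ≤ a) (hab : a < b) (hbc : b < c) (hcd : c < d)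
    (h2 : d ≤ P + M) :
    arcF P M (b - P) (d - P) a b + arcF P M (b - P) (d - P) c d - arcF P M (b - P) (d - P) b c -
      arcF P M (b - P) (d - P) a d = -2 := by
  rw [arcF_val (by omega) (by omega) (by omega) (by omega) (by omega) (by omega) (by omega),
    arcF_val (by omega) (by omega) (by omega) (by omega) (by omega) (by omega) (by omega),
    arcF_val (by omega) (by omega) (by omega) (by omega) (by omega) (by omega) (by omega),
    arcF_val (by omega) (by omega) (by omega) (by omega) (by omega) (by omega) (by omega)]
  have e : ¬ (b = P) := by omega
  have e1 : ¬ (c = P) := by omega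
  have e2 : ¬ (d = P) := by omega
  simp only [e, e1, e2, false_and, if_true, add_zero, iff_false]
  generalize (if ¬(a = P ∧ d = P + M) then (0 : ℤ) else 1) = w
  rw [if_pos (by omega), if_pos (by omega), if_neg (by omega), if_neg (by omega)]
  ring

namespace Tri

variable {n : ℕ} (T : Tri n)

/-- The arc function attached to a node. -/
def ff (i : Fin n) : ℤ → ℤ → ℤ := arcF (T.st (Sum.inl T.ρ)) T.M
  (T.st (Sum.inl i) - T.st (Sum.inl T.ρ)) (T.en (Sum.inl i) - T.st (Sum.inl T.ρ))

lemma init_root (i : Fin n) : ∑ x, T.b x T.ρ * T.ff i (T.st x) (T.en x) =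
    if i = T.ρ then -4 else 0 := by
  have hb : ∀ x, T.b x T.ρ = 2 * dl x (T.ch (true, T.ρ)) - 2 * dl x (T.ch (false, T.ρ)) := by
    intro x; unfold b; rw [T.t_col_root]; simp [dd]; ring
  simp only [hb, sub_mul, mul_assoc, Finset.sum_sub_distrib, ← Finset.mul_sum, sum_dl_mul]
  have hl1 := T.hl T.ρ
  have hl2 := T.hm T.ρ
  have hl3 := T.hr T.ρ
  have hl4 := T.lt (T.ch (false, T.ρ))
  have hl5 := T.lt (T.ch (true, T.ρ))
  have hper := T.per
  have hr := T.in_root i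
  have hlt := T.lt (Sum.inl i)
  have hmid := T.mid_root i
  rw [hl1, hl2, hl3, hper]
  unfold ff
  rw [arcF_val hr.1 hlt (by omega) (by omega) (by omega) (by omega) (by omega),
    arcF_val hr.1 hlt (by omega) (by omega) (by omega) (by omega) (by omega)]
  by_cases hi : i = T.ρ
  · subst hi
    rw [if_pos rfl]
    split_ifs <;> omega
  · rw [if_neg hi]
    have := hmid.resolve_left hi
    split_ifs <;> omega

lemma pos_cases (i m : Fin n) {b : Bool} {j : Fin n} (h : T.ch (b, m) = Sum.inl j) (hij : i ≠ j) :
    (T.st (Sum.inl i) ≤ T.st (Sum.inl m) ∧ T.en (Sum.inl m) ≤ T.en (Sum.inl i)) ∨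
    ((T.st (Sum.inl m) ≤ T.st (Sum.inl i) ∨ T.en (Sum.inl i) ≤ T.st (Sum.inl m)) ∧
     (T.st (T.ch (true, m)) ≤ T.st (Sum.inl i) ∨ T.en (Sum.inl i) ≤ T.st (T.ch (true, m))) ∧
     (T.st (T.ch (true, j)) ≤ T.st (Sum.inl i) ∨ T.en (Sum.inl i) ≤ T.st (T.ch (true, j))) ∧
     (T.en (Sum.inl m) ≤ T.st (Sum.inl i) ∨ T.en (Sum.inl i) ≤ T.en (Sum.inl m))) := by
  have m1 := T.hl m
  have m2 := T.hm m
  have m3 := T.hr m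
  have j1 := T.hl j
  have j2 := T.hm j
  have j3 := T.hr j
  have l1 := T.lt (T.ch (false, m))
  have l2 := T.lt (T.ch (true, m))
  have l3 := T.lt (T.ch (false, j))
  have l4 := T.lt (T.ch (true, j))
  have l5 := T.lt (Sum.inl i)
  have hst := congrArg T.st h
  have hen := congrArg T.en h
  rcases T.rel_all m i with hh | ⟨b1, hh⟩ | ⟨b1, hh⟩ | hh | hh
  · subst hh; left; exact ⟨le_rfl, le_rfl⟩
  · right
    unfold ins at hh
    by_cases hb : b1 = b
    · subst hb
      rw [h] at hh
      rcases T.rel_all j i with h3 | ⟨b3, h3⟩ | ⟨b3, h3⟩ | h3 | h3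
      · exact absurd h3 hij
      · unfold ins at h3
        cases b1 <;> cases b3 <;> omega
      · unfold ins at h3
        have := T.ch_st_le (b3, i)
        simp only [] at this
        omega
      · cases b1 <;> omega
      · cases b1 <;> omega
    · cases b1 <;> cases b <;> simp at hb <;> omega
  · left
    unfold ins at hh
    have := T.ch_st_le (b1, i)
    simp only [] at this
    omega
  · cases b <;> omega
  · cases b <;> omega

lemma init_left (i : Fin n) {j m : Fin n} (h : T.ch (false, m) = Sum.inl j) :
    ∑ x, T.b x j * T.ff i (T.st x) (T.en x) = if i = j then -2 else 0 := by
  have hjρ : j ≠ T.ρ := by rintro rfl; exact T.ne_root _ h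
  have hb : ∀ x, T.b x j = dl x (T.ch (true, j)) - dl x (T.ch (false, j)) + dl x (Sum.inl m)
      - dl x (T.ch (true, m)) := by
    intro x; unfold b; rw [T.t_col_left h, dd, if_neg hjρ, mul_one]
  simp only [hb, sub_mul, add_mul, Finset.sum_sub_distrib, Finset.sum_add_distrib, sum_dl_mul]
  have m1 := T.hl m
  have m2 := T.hm m
  have m3 := T.hr m
  have j1 := T.hl j
  have j2 := T.hm j
  have j3 := T.hr j
  have l2 := T.lt (T.ch (true, m))
  have l3 := T.lt (T.ch (false, j))
  have l4 := T.lt (T.ch (true, j))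
  have l5 := T.lt (Sum.inl i)
  have hper := T.per
  have hr := T.in_root i
  have hrm := T.in_root m
  rw [h] at m1 m2
  rw [j3, j2, j1, m3, m1, m2]
  unfold ff
  by_cases hij : i = j
  · subst hij
    rw [if_pos rfl]
    have := arcF_two_left (P := T.st (Sum.inl T.ρ)) (M := T.M) (a := T.st (Sum.inl m))
      (b := T.st (T.ch (true, i))) (c := T.st (T.ch (true, m)))
      (d := T.en (Sum.inl m)) (by omega) (by omega) (by omega) (by omega) (by omega)
    rw [← m1, ← m2] at this ⊢
    exact this
  · rw [if_neg hij]
    have hp := T.pos_cases i m h hij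
    have := arcF_zero (P := T.st (Sum.inl T.ρ)) (M := T.M) hr.1 l5 (by omega)
      (a := T.st (Sum.inl m)) (b := T.st (T.ch (true, j))) (c := T.st (T.ch (true, m)))
      (d := T.en (Sum.inl m)) (by omega) (by omega) (by omega) (by omega) (by omega) (by omega)
    omega

lemma init_right (i : Fin n) {j m : Fin n} (h : T.ch (true, m) = Sum.inl j) :
    ∑ x, T.b x j * T.ff i (T.st x) (T.en x) = if i = j then -2 else 0 := by
  have hjρ : j ≠ T.ρ := by rintro rfl; exact T.ne_root _ h
  have hb : ∀ x, T.b x j = dl x (T.ch (false, m)) + dl x (T.ch (true, j)) - dl x (T.ch (false, j)) -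
      dl x (Sum.inl m) := by
    intro x; unfold b; rw [T.t_col_right h, dd, if_neg hjρ, mul_one]; ring
  simp only [hb, sub_mul, add_mul, Finset.sum_sub_distrib, Finset.sum_add_distrib, sum_dl_mul]
  have m1 := T.hl m
  have m2 := T.hm m
  have m3 := T.hr m
  have j1 := T.hl j
  have j2 := T.hm j
  have j3 := T.hr j
  have l2 := T.lt (T.ch (false, m))
  have l3 := T.lt (T.ch (false, j))
  have l4 := T.lt (T.ch (true, j))
  have l5 := T.lt (Sum.inl i)
  have hper := T.per
  have hr := T.in_root i
  have hrm := T.in_root m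
  rw [h] at m3 m2
  rw [j3, j2, j1, m1, m2, m3]
  unfold ff
  by_cases hij : i = j
  · subst hij
    rw [if_pos rfl]
    have := arcF_two_right (P := T.st (Sum.inl T.ρ)) (M := T.M) (a := T.st (Sum.inl m))
      (b := T.st (Sum.inl i)) (c := T.st (T.ch (true, i)))
      (d := T.en (Sum.inl m)) (by omega) (by omega) (by omega) (by omega) (by omega)
    rw [m3]
    exact this
  · rw [if_neg hij]
    have hp := T.pos_cases i m h hij
    rw [h] at hp
    have := arcF_zero (P := T.st (Sum.inl T.ρ)) (M := T.M) hr.1 l5 (by omega)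
      (a := T.st (Sum.inl m)) (b := T.st (Sum.inl j)) (c := T.st (T.ch (true, j)))
      (d := T.en (Sum.inl m)) (by omega) (by omega) (by omega) (by omega) (by omega) (by omega)
    omega

/-- Sign-coherence for all matrices coming from trees. -/
theorem sc : SC T.mat := by
  have hM := T.M_pos
  have hper := T.per
  have hin : ∀ i, 0 ≤ T.st (Sum.inl i) - T.st (Sum.inl T.ρ) ∧
      T.en (Sum.inl i) - T.st (Sum.inl T.ρ) ≤ T.M := by
    intro i; have := T.in_root i; omega
  refine sc_of T T.ff (fun i => if i = T.ρ then 4 else 2) (fun i => by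
    by_cases h : i = T.ρ <;> simp [h]) (fun i => arcF_inv hM (hin i).1 (hin i).2)
    (fun i => arcF_ptol hM (hin i).1 (hin i).2)
    (fun i j => arcF_compat (hin i).1 (hin i).2 (hin j).1 (hin j).2 ?_) fun i j => ?_
  · have := T.laminar i j
    unfold Lam
    unfold ins at this
    omega
  · by_cases hj : j = T.ρ
    · subst hj
      rw [T.init_root]
      by_cases h : i = T.ρ <;> simp [h]
    · obtain ⟨⟨b, m⟩, h⟩ := T.cov j hj
      have : ∑ x, T.b x j * T.ff i (T.st x) (T.en x) = if i = j then -2 else 0 := by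
        cases b
        · exact T.init_left i h
        · exact T.init_right i h
      rw [this]
      by_cases hij : i = j
      · subst hij; simp [hj]
      · simp [hij]

end Tri

/-! ### The initial tree -/

/-- Partial sums of the turning data. -/
def offs (s : ℕ → Bool) : ℕ → ℤ
  | 0 => 0
  | i + 1 => offs s i - if s (i + 1) then 1 else 0

/-- Position of a node in the chain. -/
def posN {n : ℕ} (σ : Equiv.Perm (Fin n)) (v : Fin n) : ℕ := (σ.symm v).val

/-- Next node of the chain. -/
def nxt {n : ℕ} (σ : Equiv.Perm (Fin n)) (v : Fin n) : Fin n :=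
  σ ⟨(σ.symm v).val - 1, by omega⟩

/-- Children in the chain. -/
def baseCh {n : ℕ} (σ : Equiv.Perm (Fin n)) (s : ℕ → Bool) (x : Bool × Fin n) : XX n :=
  if 1 ≤ posN σ x.2 ∧ x.1 = s (posN σ x.2) then Sum.inl (nxt σ x.2) else Sum.inr x

/-- Left ends in the chain. -/
def baseSt {n : ℕ} (σ : Equiv.Perm (Fin n)) (s : ℕ → Bool) : XX n → ℤ
  | Sum.inl v => offs s (posN σ v)
  | Sum.inr (b, v) => offs s (posN σ v) + if b then (posN σ v : ℤ) + 1 else 0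

/-- Right ends in the chain. -/
def baseEn {n : ℕ} (σ : Equiv.Perm (Fin n)) (s : ℕ → Bool) : XX n → ℤ
  | Sum.inl v => offs s (posN σ v) + posN σ v + 2
  | Sum.inr (b, v) => offs s (posN σ v) + (if b then (posN σ v : ℤ) + 1 else 0) + 1

lemma posN_nxt {n : ℕ} (σ : Equiv.Perm (Fin n)) (v : Fin n) : posN σ (nxt σ v) = posN σ v - 1 := by
  simp [posN, nxt]

lemma posN_inj {n : ℕ} (σ : Equiv.Perm (Fin n)) {v w : Fin n} (h : posN σ v = posN σ w) : v = w :=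
  σ.symm.injective (Fin.ext h)

lemma posN_σ {n : ℕ} (σ : Equiv.Perm (Fin n)) (i : Fin n) : posN σ (σ i) = i.val := by
  simp [posN]

lemma baseCh_inl {n : ℕ} (σ : Equiv.Perm (Fin n)) (s : ℕ → Bool) (x : Bool × Fin n) (w : Fin n) :
    baseCh σ s x = Sum.inl w ↔ posN σ w + 1 = posN σ x.2 ∧ x.1 = s (posN σ x.2) := by
  unfold baseCh
  split_ifs with h
  · have := posN_nxt σ x.2
    constructor
    · intro e
      rw [← Sum.inl.inj e]
      exact ⟨by omega, h.2⟩
    · rintro ⟨e, -⟩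
      exact congrArg _ (posN_inj σ (by omega))
  · simp only [reduceCtorEq, false_iff]
    rintro ⟨e, e'⟩
    exact h ⟨by omega, e'⟩

lemma baseCh_cases {n : ℕ} (σ : Equiv.Perm (Fin n)) (s : ℕ → Bool) (v : Fin n) :
    (posN σ v = 0 ∧ baseCh σ s (false, v) = Sum.inr (false, v) ∧
      baseCh σ s (true, v) = Sum.inr (true, v)) ∨
    (∃ w, posN σ w + 1 = posN σ v ∧ s (posN σ w + 1) = false ∧
      baseCh σ s (false, v) = Sum.inl w ∧ baseCh σ s (true, v) = Sum.inr (true, v)) ∨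
    (∃ w, posN σ w + 1 = posN σ v ∧ s (posN σ w + 1) = true ∧
      baseCh σ s (false, v) = Sum.inr (false, v) ∧ baseCh σ s (true, v) = Sum.inl w) := by
  rcases Nat.eq_zero_or_pos (posN σ v) with h | h
  · left; simp [baseCh, h]
  · right
    have e : posN σ (nxt σ v) + 1 = posN σ v := by rw [posN_nxt]; omega
    cases hs : s (posN σ v)
    · left
      exact ⟨nxt σ v, e, by rw [e, hs], by simp [baseCh, hs]; omega, by simp [baseCh, hs]⟩
    · right
      exact ⟨nxt σ v, e, by rw [e, hs], by simp [baseCh, hs], by simp [baseCh, hs]; omega⟩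

/-- The chain tree. -/
def baseTri {n : ℕ} (hn : 0 < n) (σ : Equiv.Perm (Fin n)) (s : ℕ → Bool) : Tri n where
  ρ := σ ⟨n - 1, by omega⟩
  ch := baseCh σ s
  st := baseSt σ s
  en := baseEn σ s
  M := n + 1
  inj := by
    intro x y h
    cases hy : baseCh σ s y with
    | inl w =>
      rw [hy] at h
      rw [baseCh_inl] at h hy
      have e : x.2 = y.2 := posN_inj σ (by omega)
      exact Prod.ext (by rw [h.2, hy.2, e]) e
    | inr z =>
      have key : ∀ x, baseCh σ s x = Sum.inr z → x = z := by
        intro x h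
        unfold baseCh at h
        split_ifs at h
        exact Sum.inr.inj h
      rw [key x (h.trans hy), key y hy]
  ne_root := by
    intro x h
    rw [baseCh_inl, posN_σ] at h
    have : posN σ x.2 < n := (σ.symm x.2).2
    simp only [] at h
    omega
  cov := by
    intro v hv
    have hlt : posN σ v + 1 < n := by
      have h1 : posN σ v < n := (σ.symm v).2
      have h2 : posN σ v ≠ n - 1 := fun h => hv (posN_inj σ (by rw [posN_σ, h]))
      omega
    refine ⟨(s (posN σ v + 1), σ ⟨posN σ v + 1, hlt⟩), ?_⟩
    rw [baseCh_inl]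
    simp [posN_σ]
  hl := by
    intro v
    rcases baseCh_cases σ s v with ⟨h, h1, h2⟩ | ⟨w, h, h0, h1, h2⟩ | ⟨w, h, h0, h1, h2⟩ <;>
      rw [h1]
    · simp [baseSt]
    · simp [baseSt, ← h, offs, h0]
    · simp [baseSt]
  hm := by
    intro v
    rcases baseCh_cases σ s v with ⟨h, h1, h2⟩ | ⟨w, h, h0, h1, h2⟩ | ⟨w, h, h0, h1, h2⟩ <;>
      rw [h1, h2]
    · simp [baseSt, baseEn, h]
    · simp [baseSt, baseEn, ← h, offs, h0]; omega
    · simp [baseSt, baseEn, ← h, offs, h0]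
  hr := by
    intro v
    rcases baseCh_cases σ s v with ⟨h, h1, h2⟩ | ⟨w, h, h0, h1, h2⟩ | ⟨w, h, h0, h1, h2⟩ <;>
      rw [h2]
    · simp [baseEn, h]; ring
    · simp [baseEn, ← h, offs, h0]; omega
    · simp [baseEn, ← h, offs, h0]
  lt := by
    rintro (v | ⟨b, v⟩) <;> simp only [baseSt, baseEn] <;> omega
  per := by
    simp only [baseSt, baseEn, posN_σ]
    omega

lemma base_t {n : ℕ} (hn : 0 < n) (σ : Equiv.Perm (Fin n)) (s : ℕ → Bool) (i j : Fin n) :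
    (baseTri hn σ s).t (Sum.inl (σ i)) (Sum.inl (σ j)) =
      if i.val + 1 = j.val then (if s j.val then 1 else -1)
      else if j.val + 1 = i.val then (if s i.val then -1 else 1) else 0 := by
  have hd : ∀ b (j : Fin n), dl (Sum.inl (σ i)) ((baseTri hn σ s).ch (b, σ j)) =
      if i.val + 1 = j.val ∧ b = s j.val then 1 else 0 := by
    intro b j
    unfold dl
    refine if_congr ?_ rfl rfl
    rw [eq_comm]
    exact (baseCh_inl σ s _ _).trans (by simp [posN_σ])
  have hd' : ∀ j : Fin n, dl (Sum.inl (σ i) : XX n) (Sum.inl (σ j)) =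
      if i.val = j.val then 1 else 0 := by
    intro j
    unfold dl
    exact if_congr (by simp [Fin.ext_iff]) rfl rfl
  have hi := i.2
  have hj := j.2
  by_cases hjn : j.val + 1 = n
  · have hr : σ j = (baseTri hn σ s).ρ := congrArg σ (Fin.ext (by simp; omega))
    have := (baseTri hn σ s).t_col_root (Sum.inl (σ i))
    rw [← hr, hd, hd] at this
    rw [this]
    cases s j.val <;> simp
    · split_ifs <;> omega
    · split_ifs <;> omega
  · set m : Fin n := ⟨j.val + 1, by omega⟩ with hm
    have hc : (baseTri hn σ s).ch (s (j.val + 1), σ m) = Sum.inl (σ j) :=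
      (baseCh_inl σ s _ _).2 (by simp [posN_σ, hm])
    have hmv : m.val = j.val + 1 := rfl
    cases hs : s (j.val + 1)
    · rw [hs] at hc
      rw [(baseTri hn σ s).t_col_left hc, hd, hd, hd, hd', hmv, hs]
      by_cases h1 : i.val + 1 = j.val
      · cases s j.val <;> simp [h1] <;> omega
      · by_cases h2 : j.val + 1 = i.val
        · rw [← h2] at h1 ⊢; rw [hs]; simp [h1]
        · simp [h1, h2, Ne.symm h2]
    · rw [hs] at hc
      rw [(baseTri hn σ s).t_col_right hc, hd, hd, hd, hd', hmv, hs]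
      by_cases h1 : i.val + 1 = j.val
      · cases s j.val <;> simp [h1] <;> omega
      · by_cases h2 : j.val + 1 = i.val
        · rw [← h2] at h1 ⊢; rw [hs]; simp [h1]
        · simp [h1, h2, Ne.symm h2]

lemma exists_base {n : ℕ} (hn : 0 < n) {d : Fin n → ℤ} (hd : ∀ i, 0 < d i)
    {B : Matrix (Fin n) (Fin n) ℤ} (hB : SkD d B) (σ : Equiv.Perm (Fin n))
    (h : ∀ i j, cartanCounterpart B (σ i) (σ j) = cartanC n i j) : ∃ T : Tri n, T.mat = B := by
  classical
  let s : ℕ → Bool := fun i => if hi : i < n then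
    decide (0 < B (σ ⟨i - 1, by omega⟩) (σ ⟨i, hi⟩)) else false
  have hs : ∀ i j : Fin n, i.val + 1 = j.val → (s j.val = true ↔ 0 < B (σ i) (σ j)) := by
    intro i j hij
    have : (⟨j.val - 1, by omega⟩ : Fin n) = i := Fin.ext (by simp; omega)
    simp [s, this]
  refine ⟨baseTri hn σ s, ?_⟩
  have key : ∀ i j, (baseTri hn σ s).mat (σ i) (σ j) = B (σ i) (σ j) := by
    intro i j
    have e := h i j
    unfold Tri.mat Tri.b
    rw [base_t]
    have hdd : (baseTri hn σ s).dd (σ j) = if j.val + 1 = n then 2 else 1 := by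
      unfold Tri.dd
      refine if_congr ?_ rfl rfl
      rw [show (baseTri hn σ s).ρ = σ ⟨n - 1, by omega⟩ from rfl, σ.injective.eq_iff, Fin.ext_iff]
      simp only []
      omega
    rw [hdd]
    have hi := i.2
    have hj := j.2
    by_cases hij : i = j
    · subst hij
      rw [hB.diag hd]; simp
    · have hv : i.val ≠ j.val := fun h => hij (Fin.ext h)
      have hσ : σ i ≠ σ j := fun h => hij (σ.injective h)
      rw [cartanCounterpart, if_neg hσ, cartanC, if_neg hij] at e
      by_cases h1 : i.val + 1 = j.val
      · have h2 := hs i j h1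
        rw [if_pos h1]
        by_cases h3 : 0 < B (σ i) (σ j)
        · rw [if_pos (h2.2 h3)]
          rw [abs_of_pos h3] at e
          split_ifs at e ⊢ <;> omega
        · rw [if_neg (fun h => h3 (h2.1 h))]
          rw [abs_of_nonpos (by omega)] at e
          split_ifs at e ⊢ <;> omega
      · rw [if_neg h1]
        by_cases h1' : j.val + 1 = i.val
        · have h2 := hs j i h1'
          have hsk := hB (σ i) (σ j)
          have hdi := hd (σ i)
          have hdj := hd (σ j)
          have h4 : |B (σ i) (σ j)| = 1 := by split_ifs at e <;> omega
          have h5 : ¬ (j.val + 1 = n) := by omega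
          rw [if_pos h1', if_neg h5, mul_one]
          rcases (abs_eq (by norm_num)).1 h4 with h6 | h6
          · have : ¬ 0 < B (σ j) (σ i) := by
              intro h7; rw [h6] at hsk; have := mul_pos hdj h7; omega
            rw [if_neg (fun h => this (h2.1 h)), h6]
          · have : 0 < B (σ j) (σ i) := by
              rw [h6] at hsk
              by_contra h7
              nlinarith
            rw [if_pos (h2.2 this), h6]
        · rw [if_neg h1', zero_mul]
          have : |B (σ i) (σ j)| = 0 := by split_ifs at e <;> omega
          exact (abs_eq_zero.1 this).symm
  ext i j
  have := key (σ.symm i) (σ.symm j)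
  simpa using this

lemma tri_of_mut {n : ℕ} {k : Fin n} {B : Matrix (Fin n) (Fin n) ℤ}
    (h : ∃ T : Tri n, T.mat = mutMat k B) : ∃ T : Tri n, T.mat = B := by
  obtain ⟨T, hT⟩ := h
  obtain ⟨T', a, b, c, d, hF⟩ := T.exists_flip k
  exact ⟨T', by rw [Tri.mat_of_flip hF, hT, mutMat_mutMat]⟩

lemma tri_of_typeC {n : ℕ} (hn : 0 < n) {d : Fin n → ℤ} (hd : ∀ i, 0 < d i)
    {B : Matrix (Fin n) (Fin n) ℤ} (hB : SkD d B) (h : MatrixOfTypeC B) :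
    ∃ T : Tri n, T.mat = B := by
  obtain ⟨B', hBB, σ, hσ⟩ := h
  have h1 : SkD d B → ∃ T : Tri n, T.mat = B := by
    induction hBB using Relation.ReflTransGen.head_induction_on with
    | refl => intro h; exact exists_base hn hd h σ hσ
    | head hab _ ih =>
      obtain ⟨k, rfl⟩ := hab
      intro h
      exact tri_of_mut (ih (h.mut hd k) (h.mut hd k))
  exact h1 hB

lemma typeC_mut {n : ℕ} {B : Matrix (Fin n) (Fin n) ℤ} (k : Fin n) (h : MatrixOfTypeC B) :
    MatrixOfTypeC (mutMat k B) := by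
  obtain ⟨B', hBB, σ, hσ⟩ := h
  exact ⟨B', Relation.ReflTransGen.head ⟨k, (mutMat_mutMat k B).symm⟩ hBB, σ, hσ⟩

lemma typeC_neg {n : ℕ} {B : Matrix (Fin n) (Fin n) ℤ} (h : MatrixOfTypeC B) :
    MatrixOfTypeC (-B) := by
  obtain ⟨B', hBB, σ, hσ⟩ := h
  refine ⟨-B', ?_, σ, fun i j => ?_⟩
  · clear hσ
    induction hBB with
    | refl => exact .refl
    | tail _ h ih =>
      obtain ⟨k, rfl⟩ := h
      exact ih.tail ⟨k, (mutMat_neg k _).symm⟩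
  · rw [← hσ i j]; simp [cartanCounterpart]

/-- Recurrence for `g`-vectors of a cluster algebra of type `C_n` (`n ≥ 2`)
under a change `B ↦ B_1 = μ_k(B)` of the initial matrix: if `g` is the
`g`-vector of the `l`-th cluster variable of the seed
`μ_{k_m} ⋯ μ_{k_1}(B̃, x)` (pattern with principal coefficients and initial
matrix `B`) and `g′` is the `g`-vector of the `l`-th cluster variable of the
seed `μ_{k_m} ⋯ μ_{k_1} μ_k(B̃_1, x)` (pattern with principal coefficients
and initial matrix `B_1`), then `g′_k = -g_k` and
`g′_j = g_j + [B_{jk}]_+ g_k - B_{jk} min(g_k, 0)` for `j ≠ k`. -/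
theorem g_vector_recurrence_type_C {n : ℕ} (hn : 2 ≤ n)
    (B : Matrix (Fin n) (Fin n) ℤ) (hB : SkewSymmetrizable B)
    (htype : MatrixOfTypeC B) (k : Fin n) (ks : List (Fin n)) (l : Fin n)
    (g g' : Fin n → ℤ)
    (hg : HasGVector B g
      ((ks.foldl (fun s k' => mutSeedP k' s) (initSeedP n B)).2 l))
    (hg' : HasGVector (mutMat k B) g'
      ((ks.foldl (fun s k' => mutSeedP k' s)
          (mutSeedP k (initSeedP n (mutMat k B)))).2 l)) :
    g' k = -g k ∧
      ∀ j, j ≠ k → g' j = g j + max (B j k) 0 * g k - B j k * min (g k) 0 := by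
  obtain ⟨d, hd, hs⟩ := hB
  have hdB : SkD d B := by
    intro i j
    have := congrFun (congrFun hs j) i
    simpa [Matrix.diagonal_mul] using this
  refine recurrence_of_class hd (fun B => SkD d B ∧ MatrixOfTypeC B)
    (fun B k h => ⟨h.1.mut hd k, typeC_mut k h.2⟩) (fun B h => ⟨h.1.neg, typeC_neg h.2⟩)
    (fun B h => ?_) B ⟨hdB, htype⟩ hdB k ks l g g' hg hg'
  obtain ⟨T, rfl⟩ := tri_of_typeC (by omega) hd h.1 h.2
  exact T.sc
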